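/- arXiv:1211.0627 — 2 statements merged into one kernel-verified Lean document; each statement's English description precedes it below -/
import Mathlib

section
/- If for every finite simple 3-connected graph G the inequality C(χ(G),3) - C(χ(G),2) + C(χ(G),1) ≤ |C(G)| - |E(G)| + |V(G)| holds, then every finite simple 3-connected planar graph different from K₃ satisfies χ(G) ≤ 4. -/
open SimpleGraph

variable {V : Type*} {W : Type*}

/-- A graph is 3-connected if deleting any set of at most two vertices
leaves a connected graph. -/
def ThreeConnected (G : SimpleGraph V) : Prop :=
  ∀ S : Set V, S.ncard ≤ 2 → (G.induce Sᶜ).Connected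

/-- `C` induces a cycle in `G`: the induced subgraph on `C` is connected,
`2`-regular and has at least three vertices. -/
def IsInducedCycle (G : SimpleGraph V) (C : Set V) : Prop :=
  3 ≤ C.ncard ∧ (G.induce C).Connected ∧
    ∀ x : C, ((G.induce C).neighborSet x).ncard = 2

/-- `C` is an induced nonseparating cycle of `G`: deleting `V(C)` leaves a
connected graph (the empty graph counts as connected). -/
def IsNonsepCycle (G : SimpleGraph V) (C : Set V) : Prop :=
  IsInducedCycle G C ∧ (G.induce Cᶜ).Preconnected

/-- The set `C(G)` of induced nonseparating cycles of `G`. -/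
def nonsepCycles (G : SimpleGraph V) : Set (Set V) :=
  {C | IsNonsepCycle G C}

/-- `H` is a minor of `G`: there is a minor model assigning to each vertex of `H`
a nonempty connected branch set in `G`, pairwise disjoint, with edges of `H`
realized by edges between the corresponding branch sets. -/
def IsMinor (H : SimpleGraph W) (G : SimpleGraph V) : Prop :=
  ∃ f : W → Set V, (∀ i, (f i).Nonempty) ∧ (∀ i, (G.induce (f i)).Connected) ∧
    (Pairwise fun i j => Disjoint (f i) (f j)) ∧
    ∀ i j, H.Adj i j → ∃ a ∈ f i, ∃ b ∈ f j, G.Adj a b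

/-- The Hadwiger number of `G`: the largest `n` such that the complete graph
`K_n` is a minor of `G`. -/
noncomputable def hadwigerNumber (G : SimpleGraph V) : ℕ :=
  sSup {n | IsMinor (⊤ : SimpleGraph (Fin n)) G}

/-- `G` is planar, i.e. embeddable in the plane; by Wagner's theorem this is
equivalent to having neither a `K₅` nor a `K_{3,3}` minor, which we take as the
definition. -/
def Planar (G : SimpleGraph V) : Prop :=
  ¬ IsMinor (⊤ : SimpleGraph (Fin 5)) G ∧
  ¬ IsMinor (completeBipartiteGraph (Fin 3) (Fin 3)) G

/-! ### Connectivity of vertex sets -/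

/-- `S` is connected (or empty): every cut of `S` is crossed by an edge of `G` inside `S`. -/
def CutConnected (G : SimpleGraph V) (S : Set V) : Prop :=
  ∀ A : Set V, (∃ u ∈ S, u ∈ A) → (∃ v ∈ S, v ∉ A) →
    ∃ a ∈ S, a ∈ A ∧ ∃ b ∈ S, b ∉ A ∧ G.Adj a b

lemma induce_preconnected_iff_cutConnected {G : SimpleGraph V} {S : Set V} :
    (G.induce S).Preconnected ↔ CutConnected G S := by
  constructor
  · rintro h A ⟨u, hu, huA⟩ ⟨v, hv, hvA⟩
    obtain ⟨p⟩ := h ⟨u, hu⟩ ⟨v, hv⟩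
    obtain ⟨d, -, h1, h2⟩ := p.exists_boundary_dart (Subtype.val ⁻¹' A) huA hvA
    exact ⟨d.fst, d.fst.2, h1, d.snd, d.snd.2, h2, d.adj⟩
  · intro h u v
    by_contra hc
    obtain ⟨a, ha, ⟨ha', har⟩, b, hb, hbn, hab⟩ :=
      h {w | ∃ hw : w ∈ S, (G.induce S).Reachable u ⟨w, hw⟩} ⟨u, u.2, u.2, Reachable.refl _⟩
        ⟨v, v.2, fun ⟨_, h⟩ => hc h⟩
    exact hbn ⟨hb, har.trans (Adj.reachable (by simpa using hab))⟩

lemma induce_connected_iff_cutConnected {G : SimpleGraph V} {S : Set V} :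
    (G.induce S).Connected ↔ CutConnected G S ∧ S.Nonempty := by
  rw [connected_iff, induce_preconnected_iff_cutConnected, Set.nonempty_coe_sort]

lemma cutConnected_singleton (G : SimpleGraph V) (v : V) : CutConnected G {v} := by
  rintro A ⟨u, rfl, hu⟩ ⟨w, rfl, hw⟩
  exact absurd hu hw

lemma cutConnected_image_Icc {G : SimpleGraph V} {q : ℕ → V} {s t : ℕ}
    (h : ∀ i, s ≤ i → i < t → G.Adj (q i) (q (i + 1))) : CutConnected G (q '' Set.Icc s t) := by
  rintro A ⟨_, ⟨i, hi, rfl⟩, hiA⟩ ⟨_, ⟨j, hj, rfl⟩, hjA⟩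
  by_contra hc
  have step : ∀ k, s ≤ k → k < t → (q k ∈ A ↔ q (k + 1) ∈ A) := by
    intro k hk hkt
    have hm : q k ∈ q '' Set.Icc s t := ⟨k, ⟨hk, hkt.le⟩, rfl⟩
    have hm' : q (k + 1) ∈ q '' Set.Icc s t := ⟨k + 1, ⟨by omega, hkt⟩, rfl⟩
    constructor
    · intro hkA
      by_contra hn
      exact hc ⟨_, hm, hkA, _, hm', hn, h k hk hkt⟩
    · intro hkA
      by_contra hn
      exact hc ⟨_, hm', hkA, _, hm, hn, (h k hk hkt).symm⟩
  have all : ∀ k, s + k ≤ t → (q (s + k) ∈ A ↔ q s ∈ A) := by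
    intro k
    induction k with
    | zero => simp
    | succ k ih =>
      intro hk
      rw [← ih (by omega), ← add_assoc, step (s + k) (by omega) (by omega)]
  obtain ⟨i', rfl⟩ := Nat.exists_eq_add_of_le hi.1
  obtain ⟨j', rfl⟩ := Nat.exists_eq_add_of_le hj.1
  exact hjA ((all j' hj.2).2 ((all i' hi.2).1 hiA))

lemma threeConnected_iff_cutConnected {G : SimpleGraph V} :
    ThreeConnected G ↔ ∀ S : Set V, S.ncard ≤ 2 → CutConnected G Sᶜ ∧ Sᶜ.Nonempty := by
  simp only [ThreeConnected, induce_connected_iff_cutConnected]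

lemma ThreeConnected.cutConnected_compl_pair {G : SimpleGraph V} (h : ThreeConnected G) (u v : V) :
    CutConnected G {u, v}ᶜ :=
  (threeConnected_iff_cutConnected.1 h _ ((Set.ncard_insert_le _ _).trans (by simp))).1

/-- `D` is a connected component of the subgraph of `G` induced on `T`. -/
structure IsComponentOf (G : SimpleGraph V) (T D : Set V) : Prop where
  nonempty : D.Nonempty
  subset : D ⊆ T
  conn : CutConnected G D
  closed : ∀ a ∈ D, ∀ b ∈ T, G.Adj a b → b ∈ D

lemma exists_isComponentOf (G : SimpleGraph V) {T : Set V} {v : V} (hv : v ∈ T) :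
    ∃ D, IsComponentOf G T D ∧ v ∈ D := by
  classical
  refine ⟨{w | ∃ hw : w ∈ T, (G.induce T).Reachable ⟨v, hv⟩ ⟨w, hw⟩},
    ⟨⟨v, hv, Reachable.refl _⟩, fun _ h => h.1, ?_, ?_⟩, hv, Reachable.refl _⟩
  · intro A ⟨u, ⟨hu, hru⟩, huA⟩ ⟨w, ⟨hw, hrw⟩, hwA⟩
    obtain ⟨p⟩ := hru.symm.trans hrw
    obtain ⟨d, hd, h1, h2⟩ := p.exists_boundary_dart (Subtype.val ⁻¹' A) huA hwA
    have hf : (G.induce T).Reachable ⟨u, hu⟩ d.fst :=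
      (p.takeUntil _ (p.dart_fst_mem_support_of_mem_darts hd)).reachable
    have hs := hf.trans d.adj.reachable
    exact ⟨d.fst, ⟨d.fst.2, hru.trans hf⟩, h1, d.snd, ⟨d.snd.2, hru.trans hs⟩, h2, d.adj⟩
  · rintro a ⟨ha, hr⟩ b hb hab
    exact ⟨hb, hr.trans (Adj.reachable (by simpa using hab))⟩

lemma IsComponentOf.eq_of_mem {G : SimpleGraph V} {T D D' : Set V} (h : IsComponentOf G T D)
    (h' : IsComponentOf G T D') {v : V} (hv : v ∈ D) (hv' : v ∈ D') : D = D' := by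
  have key : ∀ {D D' : Set V}, IsComponentOf G T D → IsComponentOf G T D' → v ∈ D → v ∈ D' →
      D ⊆ D' := by
    intro D D' h h' hv hv' w hw
    by_contra hn
    obtain ⟨a, -, ha, b, hb, hb', hab⟩ := h.conn D' ⟨v, hv, hv'⟩ ⟨w, hw, hn⟩
    exact hb' (h'.closed a ha b (h.subset hb) hab)
  exact (key h h' hv hv').antisymm (key h' h hv' hv)

lemma CutConnected.of_component_unique {G : SimpleGraph V} {T : Set V}
    (h : ∀ D D', IsComponentOf G T D → IsComponentOf G T D' → D = D') : CutConnected G T := by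
  rintro A ⟨u, hu, huA⟩ ⟨v, hv, hvA⟩
  obtain ⟨D, hD, huD⟩ := exists_isComponentOf G hu
  obtain ⟨D', hD', hvD⟩ := exists_isComponentOf G hv
  obtain rfl := h D D' hD hD'
  obtain ⟨a, ha, haA, b, hb, hbA, hab⟩ := hD.conn A ⟨u, huD, huA⟩ ⟨v, hvD, hvA⟩
  exact ⟨a, hD.subset ha, haA, b, hD.subset hb, hbA, hab⟩

/-- Some edge of `G` joins `S` to `T`. -/
def Touches (G : SimpleGraph V) (S T : Set V) : Prop := ∃ a ∈ S, ∃ b ∈ T, G.Adj a b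

lemma Touches.symm {G : SimpleGraph V} {S T : Set V} (h : Touches G S T) : Touches G T S := by
  obtain ⟨a, ha, b, hb, hab⟩ := h
  exact ⟨b, hb, a, ha, hab.symm⟩

/-! ### Minors -/

lemma isMinor_iff_cutConnected {H : SimpleGraph W} {G : SimpleGraph V} :
    IsMinor H G ↔ ∃ f : W → Set V, (∀ i, (f i).Nonempty) ∧ (∀ i, CutConnected G (f i)) ∧
      (Pairwise fun i j => Disjoint (f i) (f j)) ∧ ∀ i j, H.Adj i j → Touches G (f i) (f j) := by
  refine exists_congr fun f => and_congr_right fun h => and_congr_left fun _ => ?_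
  simp only [induce_connected_iff_cutConnected, h, and_true]

lemma pairwise_get_of_symmetric {R : Set V → Set V → Prop} (hR : ∀ S T, R S T → R T S)
    {l : List (Set V)} (h : l.Pairwise R) : Pairwise fun i j => R (l.get i) (l.get j) := by
  intro i j hij
  rcases lt_or_gt_of_ne hij with hij | hij
  · exact List.pairwise_iff_get.1 h i j hij
  · exact hR _ _ (List.pairwise_iff_get.1 h j i hij)

lemma isMinor_completeBipartite_three {G : SimpleGraph V} {A₁ A₂ A₃ B₁ B₂ B₃ : Set V}
    (hc : ∀ A ∈ [A₁, A₂, A₃, B₁, B₂, B₃], CutConnected G A)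
    (hd : [A₁, A₂, A₃, B₁, B₂, B₃].Pairwise Disjoint)
    (ht : ∀ A ∈ [A₁, A₂, A₃], ∀ B ∈ [B₁, B₂, B₃], Touches G A B) :
    IsMinor (completeBipartiteGraph (Fin 3) (Fin 3)) G := by
  let e : Fin 3 ⊕ Fin 3 ≃ Fin 6 := finSumFinEquiv
  let f : Fin 3 ⊕ Fin 3 → Set V := fun i => [A₁, A₂, A₃, B₁, B₂, B₃].get (e i)
  have hf : ∀ i j, Touches G (f (.inl i)) (f (.inr j)) := by
    intro i j
    have hi : f (.inl i) = [A₁, A₂, A₃].get i := by fin_cases i <;> rfl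
    have hj : f (.inr j) = [B₁, B₂, B₃].get j := by fin_cases j <;> rfl
    exact hi ▸ hj ▸ ht _ (List.get_mem _ _) _ (List.get_mem _ _)
  refine isMinor_iff_cutConnected.2 ⟨f, ?_, fun i => hc _ (List.get_mem _ _), fun i j hij =>
    pairwise_get_of_symmetric (R := Disjoint) (fun _ _ h => h.symm) hd (e.injective.ne hij), ?_⟩
  · rintro (i | i)
    · obtain ⟨a, ha, -⟩ := hf i 0
      exact ⟨a, ha⟩
    · obtain ⟨-, -, a, ha, -⟩ := hf 0 i
      exact ⟨a, ha⟩
  · rintro (i | i) (j | j) hij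
    · simp at hij
    · exact hf i j
    · exact (hf j i).symm
    · simp at hij

lemma isMinor_top_five {G : SimpleGraph V} {A₁ A₂ A₃ A₄ A₅ : Set V}
    (hc : ∀ A ∈ [A₁, A₂, A₃, A₄, A₅], CutConnected G A)
    (hd : [A₁, A₂, A₃, A₄, A₅].Pairwise Disjoint)
    (ht : [A₁, A₂, A₃, A₄, A₅].Pairwise (Touches G)) :
    IsMinor (⊤ : SimpleGraph (Fin 5)) G := by
  refine isMinor_iff_cutConnected.2 ⟨[A₁, A₂, A₃, A₄, A₅].get, ?_,
    fun i => hc _ (List.get_mem _ _),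
    pairwise_get_of_symmetric (R := Disjoint) (fun _ _ h => h.symm) hd,
    fun i j hij => pairwise_get_of_symmetric (fun _ _ => Touches.symm) ht hij⟩
  intro i
  obtain ⟨j, hj⟩ := exists_ne i
  obtain ⟨a, ha, -⟩ := pairwise_get_of_symmetric (fun _ _ => Touches.symm) ht hj.symm
  exact ⟨a, ha⟩

/-! ### Induced cycles -/

lemma isInducedCycle_iff {G : SimpleGraph V} {C : Set V} :
    IsInducedCycle G C ↔
      3 ≤ C.ncard ∧ CutConnected G C ∧ ∀ x ∈ C, (G.neighborSet x ∩ C).ncard = 2 := by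
  have h : ∀ x : C, ((G.induce C).neighborSet x).ncard = (G.neighborSet x ∩ C).ncard := by
    intro x
    rw [← Set.ncard_image_of_injective _ Subtype.val_injective]
    congr 1
    ext v
    simp [and_comm]
  simp only [IsInducedCycle, h, Subtype.forall]
  refine and_congr_right fun hC => ?_
  have : C.Nonempty := Set.nonempty_of_ncard_ne_zero (by omega)
  rw [induce_connected_iff_cutConnected, and_iff_left this]

lemma eq_or_eq_of_mem_of_ncard_eq_two {s : Set V} (hs : s.ncard = 2) {a b c : V} (ha : a ∈ s)
    (hb : b ∈ s) (hab : a ≠ b) (hc : c ∈ s) : c = a ∨ c = b := by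
  obtain ⟨u, v, -, rfl⟩ := Set.ncard_eq_two.1 hs
  grind

lemma IsInducedCycle.eq_of_subset [Finite V] {G : SimpleGraph V} {C C' : Set V}
    (h : IsInducedCycle G C) (h' : IsInducedCycle G C') (hs : C ⊆ C') : C = C' := by
  rw [isInducedCycle_iff] at h h'
  refine hs.antisymm fun w hw => ?_
  by_contra hn
  obtain ⟨u, hu⟩ : C.Nonempty := Set.nonempty_of_ncard_ne_zero (by omega)
  obtain ⟨a, ha', ha, b, hb', hb, hab⟩ := h'.2.1 C ⟨u, hs hu, hu⟩ ⟨w, hw, hn⟩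
  have heq : G.neighborSet a ∩ C = G.neighborSet a ∩ C' :=
    Set.eq_of_subset_of_ncard_le (Set.inter_subset_inter_right _ hs)
      (by rw [h.2.2 a ha, h'.2.2 a ha'])
  exact hb (heq ▸ (⟨hab, hb'⟩ : b ∈ G.neighborSet a ∩ C') : b ∈ G.neighborSet a ∩ C).2

/-- The injective sequence `q 0, …, q n` lists the vertices of the induced cycle `C` in cyclic
order, starting from `x`. -/
structure CycleEnum (G : SimpleGraph V) (C : Set V) (x : V) (n : ℕ) (q : ℕ → V) : Prop where
  two_le : 2 ≤ n
  zero : q 0 = x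
  mem_iff : ∀ v, v ∈ C ↔ ∃ i ≤ n, q i = v
  inj : ∀ i ≤ n, ∀ j ≤ n, q i = q j → i = j
  adj : ∀ i < n, G.Adj (q i) (q (i + 1))
  last : G.Adj (q n) (q 0)
  chord : ∀ i j, i < j → j ≤ n → G.Adj (q i) (q j) → j = i + 1 ∨ (i = 0 ∧ j = n)

lemma IsInducedCycle.exists_cycleEnum [Finite V] {G : SimpleGraph V} {C : Set V}
    (h : IsInducedCycle G C) {x : V} (hx : x ∈ C) : ∃ n q, CycleEnum G C x n q := by
  have hdeg := (isInducedCycle_iff.1 h).2.2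
  obtain ⟨h3, hc, h2⟩ := h
  have hcyc : (G.induce C).IsCycles := fun v _ => h2 v
  obtain ⟨p, hp, hverts⟩ := hcyc.exists_cycle_toSubgraph_verts_eq_connectedComponentSupp
    (c := (G.induce C).connectedComponentMk ⟨x, hx⟩) (v := ⟨x, hx⟩) rfl
    (Set.nonempty_of_ncard_ne_zero (by rw [h2]; decide))
  have hlen := hp.three_le_length
  have hinj : ∀ i ≤ p.length - 1, ∀ j ≤ p.length - 1,
      (p.getVert i : V) = p.getVert j → i = j := by
    intro i hi j hj hij
    exact hp.getVert_injOn' (by simpa using hi) (by simpa using hj) (Subtype.ext hij)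
  have hadj : ∀ i < p.length, G.Adj (p.getVert i) (p.getVert (i + 1)) := fun i hi => by
    simpa using p.adj_getVert_succ hi
  have hlast : G.Adj (p.getVert (p.length - 1)) (p.getVert 0) := by
    have := hadj (p.length - 1) (by omega)
    rw [show p.length - 1 + 1 = p.length by omega, p.getVert_length] at this
    rwa [p.getVert_zero]
  refine ⟨p.length - 1, fun i => p.getVert i, ⟨by omega, by simp, ?_, hinj,
    fun i hi => hadj i (by omega), hlast, ?_⟩⟩
  · intro v
    refine ⟨fun hv => ?_, ?_⟩
    · have : (⟨v, hv⟩ : C) ∈ p.toSubgraph.verts := by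
        rw [hverts]
        exact ConnectedComponent.sound (hc.preconnected _ _)
      rw [Walk.mem_verts_toSubgraph, Walk.mem_support_iff_exists_getVert] at this
      obtain ⟨i, hi, hil⟩ := this
      rcases hil.lt_or_eq with hil | rfl
      · exact ⟨i, by omega, by rw [hi]⟩
      · exact ⟨0, by omega, congrArg Subtype.val
          ((p.getVert_zero.trans p.getVert_length.symm).trans hi)⟩
    · rintro ⟨i, -, rfl⟩
      exact (p.getVert i).2
  · intro i j hij hj hadj'
    have hd := hdeg (p.getVert i) (p.getVert i).2
    have hjm : (p.getVert j : V) ∈ G.neighborSet (p.getVert i) ∩ C := ⟨hadj', (p.getVert j).2⟩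
    have hsm : (p.getVert (i + 1) : V) ∈ G.neighborSet (p.getVert i) ∩ C :=
      ⟨hadj i (by omega), (p.getVert _).2⟩
    rcases Nat.eq_zero_or_pos i with rfl | hi
    · have hlm : (p.getVert (p.length - 1) : V) ∈ G.neighborSet (p.getVert 0) ∩ C :=
        ⟨hlast.symm, (p.getVert _).2⟩
      rcases eq_or_eq_of_mem_of_ncard_eq_two hd hsm hlm
        (fun he => by have := hinj _ (by omega) _ (by omega) he; omega) hjm with he | he
      · exact .inl (hinj _ hj _ (by omega) he)
      · exact .inr ⟨rfl, hinj _ hj _ le_rfl he⟩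
    · have hpm : (p.getVert (i - 1) : V) ∈ G.neighborSet (p.getVert i) ∩ C := by
        have := hadj (i - 1) (by omega)
        rw [show i - 1 + 1 = i by omega] at this
        exact ⟨this.symm, (p.getVert _).2⟩
      rcases eq_or_eq_of_mem_of_ncard_eq_two hd hsm hpm
        (fun he => by have := hinj _ (by omega) _ (by omega) he; omega) hjm with he | he
      · exact .inl (hinj _ hj _ (by omega) he)
      · have := hinj _ hj _ (by omega) he
        omega

/-! ### Planar graphs around a contractible edge -/

/-- The edge `xy` of `G` stays out of every vertex cut of size three. -/
structure ContractibleEdge (G : SimpleGraph V) (x y : V) : Prop where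
  adj : G.Adj x y
  conn : ∀ z, CutConnected G {x, y, z}ᶜ

lemma ContractibleEdge.symm {G : SimpleGraph V} {x y : V} (h : ContractibleEdge G x y) :
    ContractibleEdge G y x :=
  ⟨h.adj.symm, fun z => Set.insert_comm x y {z} ▸ h.conn z⟩

/-- Some vertex of `D` is adjacent to `v`. -/
def Attaches (G : SimpleGraph V) (D : Set V) (v : V) : Prop := ∃ d ∈ D, G.Adj d v

section

variable {G : SimpleGraph V} {C : Set V} {x y : V} {n : ℕ} {q : ℕ → V}

lemma CycleEnum.mem (hC : CycleEnum G C x n q) {i : ℕ} (hi : i ≤ n) : q i ∈ C :=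
  (hC.mem_iff _).2 ⟨i, hi, rfl⟩

lemma CycleEnum.ne (hC : CycleEnum G C x n q) {i j : ℕ} (hi : i ≤ n) (hj : j ≤ n) (hij : i ≠ j) :
    q i ≠ q j := fun h => hij (hC.inj i hi j hj h)

lemma CycleEnum.ne_start (hC : CycleEnum G C x n q) {i : ℕ} (hi : i ≤ n) (h0 : 1 ≤ i) :
    q i ≠ x := hC.zero ▸ hC.ne hi (Nat.zero_le _) (by omega)

lemma CycleEnum.start_mem (hC : CycleEnum G C x n q) : x ∈ C :=
  hC.zero ▸ hC.mem (Nat.zero_le _)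

lemma CycleEnum.adj_first (hC : CycleEnum G C x n q) : G.Adj x (q 1) := by
  have := hC.adj 0 (by have := hC.two_le; omega)
  rwa [hC.zero] at this

lemma CycleEnum.adj_last (hC : CycleEnum G C x n q) : G.Adj x (q n) := by
  have := hC.last.symm
  rwa [hC.zero] at this

lemma CycleEnum.cutConnected_Icc (hC : CycleEnum G C x n q) {s t : ℕ} (ht : t ≤ n) :
    CutConnected G (q '' Set.Icc s t) :=
  cutConnected_image_Icc fun i _ hi => hC.adj i (by omega)

lemma CycleEnum.image_Icc_subset (hC : CycleEnum G C x n q) {s t : ℕ} (hs : 1 ≤ s) (ht : t ≤ n) :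
    ∀ v ∈ q '' Set.Icc s t, v ∈ C ∧ v ≠ x := by
  rintro _ ⟨i, hi, rfl⟩
  exact ⟨hC.mem (hi.2.trans ht), hC.ne_start (hi.2.trans ht) (hs.trans hi.1)⟩

lemma CycleEnum.disjoint_Icc (hC : CycleEnum G C x n q) {s t s' t' : ℕ} (ht : t < s')
    (ht' : t' ≤ n) : Disjoint (q '' Set.Icc s t) (q '' Set.Icc s' t') := by
  rw [Set.disjoint_left]
  rintro _ ⟨i, hi, rfl⟩ ⟨j, hj, hij⟩
  simp only [Set.mem_Icc] at hi hj
  exact hC.ne (by omega) (by omega) (by omega) hij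

lemma IsComponentOf.attaches_of_nonseparating {D : Set V}
    (hD : IsComponentOf G {v | v ∉ C ∧ v ≠ y} D) (hy : y ∉ C) (hns : CutConnected G Cᶜ) :
    Attaches G D y := by
  obtain ⟨d, hd⟩ := hD.nonempty
  obtain ⟨a, -, ha, b, hbC, hbD, hab⟩ :=
    hns D ⟨d, (hD.subset hd).1, hd⟩ ⟨y, hy, fun h => (hD.subset h).2 rfl⟩
  by_cases hby : b = y
  · exact ⟨a, ha, hby ▸ hab⟩
  · exact absurd (hD.closed a ha b ⟨hbC, hby⟩ hab) hbD

lemma CycleEnum.exists_straddling (hC : CycleEnum G C x n q) (he : ContractibleEdge G x y)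
    (hy : y ∉ C) {k : ℕ} (hk : 1 < k) (hkn : k < n) :
    ∃ D, IsComponentOf G {v | v ∉ C ∧ v ≠ y} D ∧ (∃ i, 1 ≤ i ∧ i < k ∧ Attaches G D (q i)) ∧
      ∃ j, k < j ∧ j ≤ n ∧ Attaches G D (q j) := by
  by_contra hcon
  have hmem : ∀ i, 1 ≤ i → i ≤ n → i ≠ k → q i ∈ ({x, y, q k}ᶜ : Set V) := by
    intro i hi hin hik
    simp only [Set.mem_compl_iff, Set.mem_insert_iff, Set.mem_singleton_iff, not_or]
    exact ⟨hC.ne_start hin hi, fun h => hy (h ▸ hC.mem hin), hC.ne hin hkn.le hik⟩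
  let X : Set V := {v | (∃ i, 1 ≤ i ∧ i < k ∧ q i = v) ∨
    ∃ D, IsComponentOf G {v | v ∉ C ∧ v ≠ y} D ∧ v ∈ D ∧ ∃ i, 1 ≤ i ∧ i < k ∧ Attaches G D (q i)}
  have hX : ∀ j, k < j → j ≤ n → q j ∉ X := by
    rintro j hkj hjn (⟨i, -, hi, hij⟩ | ⟨D, hD, hjD, -⟩)
    · exact hC.ne (by omega) hjn (by omega) hij
    · exact (hD.subset hjD).1 (hC.mem hjn)
  obtain ⟨a, -, haX, b, hb, hbX, hab⟩ := he.conn (q k) X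
    ⟨q 1, hmem 1 le_rfl (by omega) (by omega), .inl ⟨1, le_rfl, hk, rfl⟩⟩
    ⟨q n, hmem n (by omega) le_rfl (by omega), hX n hkn le_rfl⟩
  simp only [Set.mem_compl_iff, Set.mem_insert_iff, Set.mem_singleton_iff, not_or] at hb
  obtain ⟨hbx, hby, hbk⟩ := hb
  by_cases hbC : b ∈ C
  · obtain ⟨j, hj, rfl⟩ := (hC.mem_iff b).1 hbC
    have hj0 : j ≠ 0 := by rintro rfl; exact hbx hC.zero
    have hkj : k < j := by
      by_contra hle
      have hjk : j ≠ k := by rintro rfl; exact hbk rfl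
      exact hbX (.inl ⟨j, by omega, by omega, rfl⟩)
    rcases haX with ⟨i, hi1, hik, rfl⟩ | ⟨D, hD, haD, hi⟩
    · have := hC.chord i j (by omega) hj hab
      omega
    · exact hcon ⟨D, hD, hi, j, hkj, hj, a, haD, hab⟩
  · obtain ⟨D, hD, hbD⟩ := exists_isComponentOf G (T := {v | v ∉ C ∧ v ≠ y}) ⟨hbC, hby⟩
    rcases haX with ⟨i, hi1, hik, rfl⟩ | ⟨D', hD', haD', hi⟩
    · exact hbX (.inr ⟨D, hD, hbD, i, hi1, hik, b, hbD, hab.symm⟩)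
    · exact hbX (.inr ⟨D', hD', hD'.closed a haD' b ⟨hbC, hby⟩ hab, hi⟩)

lemma IsComponentOf.exists_two_attachments {D : Set V}
    (hD : IsComponentOf G {v | v ∉ C ∧ v ≠ y} D) (hC : CycleEnum G C x n q)
    (he : ContractibleEdge G x y) (hy : y ∉ C) :
    ∃ i j, 1 ≤ i ∧ i < j ∧ j ≤ n ∧ Attaches G D (q i) ∧ Attaches G D (q j) := by
  have h2 := hC.two_le
  have key : ∀ k, 1 ≤ k → k ≤ n → ∃ i, 1 ≤ i ∧ i ≤ n ∧ i ≠ k ∧ Attaches G D (q i) := by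
    intro k hk hkn
    obtain ⟨d, hd⟩ := hD.nonempty
    have hout : ∀ v ∈ D, v ∈ ({x, y, q k}ᶜ : Set V) := by
      intro v hv
      have hvT := hD.subset hv
      simp only [Set.mem_compl_iff, Set.mem_insert_iff, Set.mem_singleton_iff, not_or]
      exact ⟨fun h => hvT.1 (h ▸ hC.start_mem), hvT.2, fun h => hvT.1 (h ▸ hC.mem hkn)⟩
    obtain ⟨l, hl1, hln, hlk⟩ : ∃ l, 1 ≤ l ∧ l ≤ n ∧ l ≠ k := by
      by_cases h : k = 1
      · exact ⟨2, by omega, h2, by omega⟩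
      · exact ⟨1, le_rfl, by omega, by omega⟩
    obtain ⟨a, -, ha, b, hb, hbD, hab⟩ := he.conn (q k) D ⟨d, hout d hd, hd⟩
      ⟨q l, by
        simp only [Set.mem_compl_iff, Set.mem_insert_iff, Set.mem_singleton_iff, not_or]
        exact ⟨hC.ne_start hln hl1, fun h => hy (h ▸ hC.mem hln), hC.ne hln hkn hlk⟩,
        fun h => (hD.subset h).1 (hC.mem hln)⟩
    simp only [Set.mem_compl_iff, Set.mem_insert_iff, Set.mem_singleton_iff, not_or] at hb
    by_cases hbC : b ∈ C
    · obtain ⟨j, hj, rfl⟩ := (hC.mem_iff b).1 hbC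
      refine ⟨j, ?_, hj, ?_, a, ha, hab⟩
      · rcases Nat.eq_zero_or_pos j with rfl | h
        · exact absurd hC.zero hb.1
        · exact h
      · rintro rfl
        exact hb.2.2 rfl
    · exact absurd (hD.closed a ha b ⟨hbC, hb.2.1⟩ hab) hbD
  obtain ⟨i, hi, hin, -, hai⟩ := key 1 le_rfl (by omega)
  obtain ⟨j, hj, hjn, hji, haj⟩ := key i hi hin
  rcases lt_or_gt_of_ne hji with h | h
  · exact ⟨j, i, hj, h, hin, haj, hai⟩
  · exact ⟨i, j, hi, h, hjn, hai, haj⟩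

/-- In a planar graph, no two components of `G - C - y` can straddle the same edge of `C - x`. -/
lemma IsComponentOf.eq_of_straddle {D D' : Set V}
    (hD : IsComponentOf G {v | v ∉ C ∧ v ≠ y} D) (hD' : IsComponentOf G {v | v ∉ C ∧ v ≠ y} D')
    (hC : CycleEnum G C x n q) (he : ContractibleEdge G x y) (hy : y ∉ C)
    (hns : CutConnected G Cᶜ) (hpl : Planar G) {s i j i' j' : ℕ}
    (hi : 1 ≤ i) (his : i ≤ s) (hsj : s < j) (hj : j ≤ n)
    (hi' : 1 ≤ i') (his' : i' ≤ s) (hsj' : s < j') (hj' : j' ≤ n)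
    (hai : Attaches G D (q i)) (haj : Attaches G D (q j))
    (hai' : Attaches G D' (q i')) (haj' : Attaches G D' (q j')) : D = D' := by
  by_contra hne
  have hA := hC.image_Icc_subset (s := 1) (t := s) le_rfl (by omega)
  have hB := hC.image_Icc_subset (s := s + 1) (t := n) (by omega) le_rfl
  have hAB := hC.disjoint_Icc (s := 1) (t := s) (s' := s + 1) (t' := n) (by omega) le_rfl
  have hDD : Disjoint D D' := Set.disjoint_left.2 fun v hv hv' => hne (hD.eq_of_mem hD' hv hv')
  have hx := hC.start_mem
  have mA : ∀ l, 1 ≤ l → l ≤ s → q l ∈ q '' Set.Icc 1 s := fun l h h' => ⟨l, ⟨h, h'⟩, rfl⟩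
  have mB : ∀ l, s < l → l ≤ n → q l ∈ q '' Set.Icc (s + 1) n := fun l h h' => ⟨l, ⟨h, h'⟩, rfl⟩
  obtain ⟨d, hd, hdy⟩ := hD.attaches_of_nonseparating hy hns
  obtain ⟨d', hd', hdy'⟩ := hD'.attaches_of_nonseparating hy hns
  obtain ⟨di, hdi, hdi'⟩ := hai
  obtain ⟨dj, hdj, hdj'⟩ := haj
  obtain ⟨ei, hei, hei'⟩ := hai'
  obtain ⟨ej, hej, hej'⟩ := haj'
  have sD := hD.subset
  have sD' := hD'.subset
  refine hpl.2 (isMinor_completeBipartite_three (A₁ := q '' Set.Icc 1 s)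
    (A₂ := q '' Set.Icc (s + 1) n) (A₃ := {y}) (B₁ := D) (B₂ := D') (B₃ := {x}) ?_ ?_ ?_)
  · simp only [List.forall_mem_cons]
    exact ⟨hC.cutConnected_Icc (by omega), hC.cutConnected_Icc le_rfl,
      cutConnected_singleton _ _, hD.conn, hD'.conn, cutConnected_singleton _ _, by simp⟩
  · rw [Set.disjoint_left] at hAB hDD
    simp only [Set.subset_def, Set.mem_ofPred_eq] at sD sD'
    clear * - hA hB hAB hDD hx hy sD sD'
    generalize q '' Set.Icc 1 s = A, q '' Set.Icc (s + 1) n = B at *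
    simp only [List.pairwise_cons, List.forall_mem_cons, Set.disjoint_left,
      Set.mem_singleton_iff, List.not_mem_nil, List.Pairwise.nil]
    and_intros <;> grind
  · simp only [List.forall_mem_cons]
    exact ⟨⟨⟨_, mA i hi his, di, hdi, hdi'.symm⟩, ⟨_, mA i' hi' his', ei, hei, hei'.symm⟩,
      ⟨_, mA 1 le_rfl (by omega), x, rfl, hC.adj_first.symm⟩, by simp⟩,
      ⟨⟨_, mB j hsj hj, dj, hdj, hdj'.symm⟩, ⟨_, mB j' hsj' hj', ej, hej, hej'.symm⟩,
      ⟨_, mB n (by omega) le_rfl, x, rfl, hC.adj_last.symm⟩, by simp⟩,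
      ⟨⟨y, rfl, d, hd, hdy.symm⟩, ⟨y, rfl, d', hd', hdy'.symm⟩, ⟨y, rfl, x, rfl, he.adj.symm⟩,
      by simp⟩, by simp⟩

lemma CycleEnum.eq_first_or_last_of_adj (hC : CycleEnum G C x n q) (he : ContractibleEdge G x y)
    (hy : y ∉ C) (hns : CutConnected G Cᶜ) (hpl : Planar G) {k : ℕ} (hk : 1 ≤ k) (hkn : k ≤ n)
    (hyk : G.Adj y (q k)) : k = 1 ∨ k = n := by
  by_contra! hne
  obtain ⟨D, hD, ⟨i, hi, hik, hai⟩, j, hkj, hj, haj⟩ :=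
    hC.exists_straddling he hy (k := k) (by omega) (by omega)
  have hA := hC.image_Icc_subset (s := 1) (t := k - 1) le_rfl (by omega)
  have hB := hC.image_Icc_subset (s := k + 1) (t := n) (by omega) le_rfl
  have hAB := hC.disjoint_Icc (s := 1) (t := k - 1) (s' := k + 1) (t' := n) (by omega) le_rfl
  have hAk := hC.disjoint_Icc (s := 1) (t := k - 1) (s' := k) (t' := k) (by omega) hkn
  have hBk := hC.disjoint_Icc (s := k) (t := k) (s' := k + 1) (t' := n) (by omega) le_rfl
  have hx := hC.start_mem
  have hk1 := hC.mem hkn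
  have hk2 := hC.ne_start hkn hk
  have mA : ∀ l, 1 ≤ l → l < k → q l ∈ q '' Set.Icc 1 (k - 1) :=
    fun l h h' => ⟨l, ⟨h, by omega⟩, rfl⟩
  have mB : ∀ l, k < l → l ≤ n → q l ∈ q '' Set.Icc (k + 1) n := fun l h h' => ⟨l, ⟨h, h'⟩, rfl⟩
  obtain ⟨d, hd, hdy⟩ := hD.attaches_of_nonseparating hy hns
  obtain ⟨di, hdi, hdi'⟩ := hai
  obtain ⟨dj, hdj, hdj'⟩ := haj
  have sD := hD.subset
  have hprev := hC.adj (k - 1) (by omega)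
  rw [show k - 1 + 1 = k by omega] at hprev
  refine hpl.2 (isMinor_completeBipartite_three (A₁ := q '' Set.Icc 1 (k - 1))
    (A₂ := q '' Set.Icc (k + 1) n) (A₃ := {y}) (B₁ := D) (B₂ := {q k}) (B₃ := {x}) ?_ ?_ ?_)
  · simp only [List.forall_mem_cons]
    exact ⟨hC.cutConnected_Icc (by omega), hC.cutConnected_Icc le_rfl,
      cutConnected_singleton _ _, hD.conn, cutConnected_singleton _ _,
      cutConnected_singleton _ _, by simp⟩
  · rw [Set.Icc_self, Set.image_singleton] at hAk hBk
    rw [Set.disjoint_left] at hAB hAk hBk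
    simp only [Set.subset_def, Set.mem_ofPred_eq, Set.mem_singleton_iff] at sD hAk hBk
    clear * - hA hB hAB hAk hBk hx hy hk1 hk2 sD
    generalize q '' Set.Icc 1 (k - 1) = A, q '' Set.Icc (k + 1) n = B at *
    simp only [List.pairwise_cons, List.forall_mem_cons, Set.disjoint_left,
      Set.mem_singleton_iff, List.not_mem_nil, List.Pairwise.nil]
    and_intros <;> grind
  · simp only [List.forall_mem_cons]
    exact ⟨⟨⟨_, mA i hi hik, di, hdi, hdi'.symm⟩, ⟨_, mA (k - 1) (by omega) (by omega), _, rfl,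
      hprev⟩, ⟨_, mA 1 le_rfl (by omega), x, rfl, hC.adj_first.symm⟩, by simp⟩,
      ⟨⟨_, mB j hkj hj, dj, hdj, hdj'.symm⟩, ⟨_, mB (k + 1) (by omega) (by omega), _, rfl,
      (hC.adj k (by omega)).symm⟩, ⟨_, mB n (by omega) le_rfl, x, rfl, hC.adj_last.symm⟩,
      by simp⟩,
      ⟨⟨y, rfl, d, hd, hdy.symm⟩, ⟨y, rfl, _, rfl, hyk⟩, ⟨y, rfl, x, rfl, he.adj.symm⟩,
      by simp⟩, by simp⟩

lemma CycleEnum.cutConnected_compl_insert (hC : CycleEnum G C x n q) (he : ContractibleEdge G x y)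
    (hy : y ∉ C) (hns : CutConnected G Cᶜ) (hpl : Planar G) :
    CutConnected G {v | v ∉ C ∧ v ≠ y} := by
  classical
  refine CutConnected.of_component_unique fun D D' hD hD' => ?_
  obtain ⟨i, j, hi, hij, hj, hai, haj⟩ := hD.exists_two_attachments hC he hy
  obtain ⟨i', j', hi', hij', hj', hai', haj'⟩ := hD'.exists_two_attachments hC he hy
  by_contra hne
  have key : ∀ {D D' : Set V} {i j i' j' : ℕ}, IsComponentOf G {v | v ∉ C ∧ v ≠ y} D →
      IsComponentOf G {v | v ∉ C ∧ v ≠ y} D' → D ≠ D' → 1 ≤ i → i < j → Attaches G D (q i) →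
      Attaches G D (q j) → 1 ≤ i' → i' < j' → j' ≤ n → Attaches G D' (q i') →
      Attaches G D' (q j') → ¬ j ≤ i' := by
    intro D D' i j i' j' hD hD' hne hi hij hai haj hi' hij' hj' hai' haj' hle
    obtain ⟨r, hr⟩ : ∃ r, r = Nat.findGreatest (fun l => Attaches G D (q l)) n := ⟨_, rfl⟩
    have hjr : j ≤ r := hr ▸ Nat.le_findGreatest (by omega) haj
    have hrn : r ≤ n := hr ▸ Nat.findGreatest_le n
    have har : Attaches G D (q r) :=
      hr ▸ Nat.findGreatest_spec (P := fun l => Attaches G D (q l)) (show j ≤ n by omega) haj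
    have hri : r ≤ i' := by
      by_contra hlt
      exact hne (hD.eq_of_straddle hD' hC he hy hns hpl (s := i') hi (by omega) (by omega) hrn
        hi' le_rfl hij' hj' hai har hai' haj')
    obtain ⟨E, hE, ⟨a, ha, har', haE⟩, b, hrb, hbn, hbE⟩ :=
      hC.exists_straddling he hy (k := r) (by omega) (by omega)
    obtain rfl := hD.eq_of_straddle hE hC he hy hns hpl (s := r - 1) hi (by omega) (by omega) hrn
      ha (by omega) (by omega) hbn hai har haE hbE
    have : b ≤ r := hr ▸ Nat.le_findGreatest hbn hbE
    omega
  have h1 := key hD hD' hne hi hij hai haj hi' hij' hj' hai' haj'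
  have h2 := key hD' hD (Ne.symm hne) hi' hij' hai' haj' hi hij hj hai haj
  rcases le_total i i' with h | h
  · exact hne (hD.eq_of_straddle hD' hC he hy hns hpl (s := i') hi h (by omega) hj hi' le_rfl
      hij' hj' hai haj hai' haj')
  · exact hne (hD.eq_of_straddle hD' hC he hy hns hpl (s := i) hi le_rfl hij hj hi' h
      (by omega) hj' hai haj hai' haj')

end

section

variable {G : SimpleGraph V} {C : Set V} {x y : V}

/-- Exchanging the ends of a contractible edge never turns an induced nonseparating cycle of a
planar graph into another one. -/
lemma not_isNonsepCycle_exchange [Finite V] (h3 : ThreeConnected G) (hpl : Planar G)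
    (he : ContractibleEdge G x y) (hcard : 5 ≤ Nat.card V) (hx : x ∈ C) (hy : y ∉ C)
    (hC : IsNonsepCycle G C) : ¬ IsNonsepCycle G (insert y (C \ {x})) := by
  intro hC'
  obtain ⟨hC, hns⟩ := hC
  obtain ⟨hC', hns'⟩ := hC'
  rw [induce_preconnected_iff_cutConnected] at hns hns'
  obtain ⟨n, q, hq⟩ := hC.exists_cycleEnum hx
  have h2 := hq.two_le
  have hxy := he.adj.ne
  obtain ⟨hy1, hyn⟩ : G.Adj y (q 1) ∧ G.Adj y (q n) := by
    have hsub : G.neighborSet y ∩ insert y (C \ {x}) ⊆ {q 1, q n} := by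
      rintro v ⟨hyv, rfl | ⟨hvC, hvx⟩⟩
      · exact absurd hyv (G.loopless.irrefl _)
      · obtain ⟨k, hk, rfl⟩ := (hq.mem_iff v).1 hvC
        have hk0 : 1 ≤ k := by
          rcases Nat.eq_zero_or_pos k with rfl | h
          · exact absurd hq.zero hvx
          · exact h
        rcases hq.eq_first_or_last_of_adj he hy hns hpl hk0 hk hyv with rfl | rfl <;> simp
    have heq := Set.eq_of_subset_of_ncard_le hsub
      (by
        rw [(isInducedCycle_iff.1 hC').2.2 y (Set.mem_insert _ _)]
        exact (Set.ncard_insert_le _ _).trans (by simp))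
    constructor
    · exact (heq ▸ Set.mem_insert _ _ : q 1 ∈ G.neighborSet y ∩ insert y (C \ {x})).1
    · exact (heq ▸ Set.mem_insert_of_mem _ rfl : q n ∈ G.neighborSet y ∩ insert y (C \ {x})).1
  have hZ := hq.cutConnected_compl_insert he hy hns hpl
  have hxZ : (∃ z, z ∉ C ∧ z ≠ y) → ∃ z, (z ∉ C ∧ z ≠ y) ∧ G.Adj x z := by
    rintro ⟨z, hz, hzy⟩
    obtain ⟨_, -, rfl, b, hb, hbx, hab⟩ := hns' {x} ⟨x, by simp [hxy], rfl⟩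
      ⟨z, by simp [hz, hzy], fun h => hz (h ▸ hx)⟩
    refine ⟨b, ⟨fun h => hb (.inr ⟨h, hbx⟩), fun h => hb (.inl h)⟩, hab⟩
  have hyZ : (∃ z, z ∉ C ∧ z ≠ y) → ∃ z, (z ∉ C ∧ z ≠ y) ∧ G.Adj y z := by
    rintro ⟨z, hz, hzy⟩
    obtain ⟨_, -, rfl, b, hb, hby, hab⟩ := hns {y} ⟨y, hy, rfl⟩ ⟨z, hz, hzy⟩
    exact ⟨b, ⟨hb, hby⟩, hab⟩
  have h1C := hq.mem (i := 1) (by omega)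
  have hnC := hq.mem (i := n) le_rfl
  have h1x := hq.ne_start (i := 1) (by omega) le_rfl
  have hnx := hq.ne_start (i := n) le_rfl (by omega)
  have h1n := hq.ne (i := 1) (j := n) (by omega) le_rfl (by omega)
  rcases h2.eq_or_lt with rfl | h2
  · have hZne : {v | v ∉ C ∧ v ≠ y}.Nonempty := by
      by_contra hne
      have hle : Nat.card V ≤ ({x, y, q 1, q 2} : Set V).ncard := by
        rw [← Set.ncard_univ]
        refine Set.ncard_le_ncard fun v _ => ?_
        by_cases hvC : v ∈ C
        · obtain ⟨i, hi, rfl⟩ := (hq.mem_iff v).1 hvC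
          interval_cases i <;> simp [hq.zero]
        · have : v = y := by
            by_contra hvy
            exact hne ⟨v, hvC, hvy⟩
          simp [this]
      have : ({x, y, q 1, q 2} : Set V).ncard ≤ 4 := by
        refine (Set.ncard_insert_le _ _).trans (Nat.succ_le_succ ?_)
        refine (Set.ncard_insert_le _ _).trans (Nat.succ_le_succ ?_)
        exact (Set.ncard_insert_le _ _).trans (by simp)
      omega
    obtain ⟨zx, hzx, hxz⟩ := hxZ hZne
    obtain ⟨zy, hzy, hyz⟩ := hyZ hZne
    obtain ⟨i, j, hi, hij, hj, ⟨a, ha, hai⟩, b, hb, hbj⟩ :=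
      (⟨hZne, subset_rfl, hZ, fun _ _ b hb _ => hb⟩ :
        IsComponentOf G {v | v ∉ C ∧ v ≠ y} _).exists_two_attachments hq he hy
    obtain rfl : i = 1 := by omega
    obtain rfl : j = 2 := by omega
    refine hpl.1 (isMinor_top_five (A₁ := {x}) (A₂ := {y}) (A₃ := {q 1}) (A₄ := {q 2})
      (A₅ := {v | v ∉ C ∧ v ≠ y}) ?_ ?_ ?_)
    · simp [cutConnected_singleton, hZ]
    · simp only [List.pairwise_cons, List.forall_mem_cons, Set.disjoint_left,
        Set.mem_singleton_iff, List.not_mem_nil, List.Pairwise.nil, Set.mem_ofPred_eq]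
      clear * - hx hy h1x hnx h1n h1C hnC
      and_intros <;> grind
    · simp only [List.pairwise_cons, List.forall_mem_cons]
      exact ⟨⟨⟨x, rfl, y, rfl, he.adj⟩, ⟨x, rfl, _, rfl, hq.adj_first⟩,
        ⟨x, rfl, _, rfl, hq.adj_last⟩, ⟨x, rfl, zx, hzx, hxz⟩, by simp⟩,
        ⟨⟨y, rfl, _, rfl, hy1⟩, ⟨y, rfl, _, rfl, hyn⟩, ⟨y, rfl, zy, hzy, hyz⟩, by simp⟩,
        ⟨⟨_, rfl, _, rfl, hq.adj 1 (by omega)⟩, ⟨_, rfl, a, ha, hai.symm⟩, by simp⟩,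
        ⟨⟨_, rfl, b, hb, hbj.symm⟩, by simp⟩, by simp⟩
  · have hZne : ∃ z, z ∉ C ∧ z ≠ y := by
      obtain ⟨D, hD, -⟩ := hq.exists_straddling he hy (k := 2) (by omega) h2
      exact hD.nonempty.imp fun z hz => hD.subset hz
    obtain ⟨zx, hzx, hxz⟩ := hxZ hZne
    obtain ⟨zy, hzy, hyz⟩ := hyZ hZne
    obtain ⟨z, hz, h2z⟩ : ∃ z, (z ∉ C ∧ z ≠ y) ∧ G.Adj (q 2) z := by
      obtain ⟨_, -, rfl, b, hb, hb2, hab⟩ := h3.cutConnected_compl_pair (q 1) (q 3) {q 2}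
        ⟨q 2, by simp [hq.ne (i := 2) (j := 1), hq.ne (i := 2) (j := 3), show 2 ≤ n by omega,
          show 1 ≤ n by omega, show 3 ≤ n by omega], rfl⟩
        ⟨x, by simp [Ne.symm h1x, (hq.ne_start (i := 3) h2 (by omega)).symm],
          (hq.ne_start (i := 2) (by omega) (by omega)).symm⟩
      simp only [Set.mem_compl_iff, Set.mem_insert_iff, Set.mem_singleton_iff, not_or] at hb hb2
      refine ⟨b, ⟨fun hbC => ?_, ?_⟩, hab⟩
      · obtain ⟨j, hj, rfl⟩ := (hq.mem_iff b).1 hbC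
        rcases lt_trichotomy j 2 with hj2 | rfl | hj2
        · have := hq.chord j 2 hj2 (by omega) hab.symm
          rcases this with h | h
          · obtain rfl : j = 1 := by omega
            exact hb.1 rfl
          · omega
        · exact hb2 rfl
        · have := hq.chord 2 j hj2 hj hab
          rcases this with rfl | h
          · exact hb.2 rfl
          · omega
      · rintro rfl
        have := hq.eq_first_or_last_of_adj he hy hns hpl (k := 2) (by omega) (by omega) hab.symm
        omega
    have hB := hq.image_Icc_subset (s := 2) (t := n - 1) (by omega) (by omega)
    have hB1 := hq.disjoint_Icc (s := 1) (t := 1) (s' := 2) (t' := n - 1) (by omega) (by omega)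
    have hBn := hq.disjoint_Icc (s := 2) (t := n - 1) (s' := n) (t' := n) (by omega) le_rfl
    have mB : ∀ l, 2 ≤ l → l ≤ n - 1 → q l ∈ q '' Set.Icc 2 (n - 1) :=
      fun l h h' => ⟨l, ⟨h, h'⟩, rfl⟩
    have hlast := hq.adj (n - 1) (by omega)
    rw [show n - 1 + 1 = n by omega] at hlast
    refine hpl.2 (isMinor_completeBipartite_three (A₁ := {x}) (A₂ := {y})
      (A₃ := q '' Set.Icc 2 (n - 1)) (B₁ := {q 1}) (B₂ := {q n})
      (B₃ := {v | v ∉ C ∧ v ≠ y}) ?_ ?_ ?_)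
    · simp [cutConnected_singleton, hZ, hq.cutConnected_Icc]
    · rw [Set.Icc_self, Set.image_singleton, Set.disjoint_left] at hB1 hBn
      simp only [Set.mem_singleton_iff] at hB1 hBn
      clear * - hx hy h1x hnx h1n h1C hnC hB hB1 hBn
      generalize q '' Set.Icc 2 (n - 1) = B at *
      simp only [List.pairwise_cons, List.forall_mem_cons, Set.disjoint_left,
        Set.mem_singleton_iff, List.not_mem_nil, List.Pairwise.nil, Set.mem_ofPred_eq]
      and_intros <;> grind
    · simp only [List.forall_mem_cons]
      exact ⟨⟨⟨x, rfl, _, rfl, hq.adj_first⟩, ⟨x, rfl, _, rfl, hq.adj_last⟩,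
        ⟨x, rfl, zx, hzx, hxz⟩, by simp⟩,
        ⟨⟨y, rfl, _, rfl, hy1⟩, ⟨y, rfl, _, rfl, hyn⟩, ⟨y, rfl, zy, hzy, hyz⟩, by simp⟩,
        ⟨⟨_, mB 2 le_rfl (by omega), _, rfl, (hq.adj 1 (by omega)).symm⟩,
        ⟨_, mB (n - 1) (by omega) le_rfl, _, rfl, hlast⟩,
        ⟨_, mB 2 le_rfl (by omega), z, hz, h2z⟩, by simp⟩, by simp⟩

end

/-! ### Contractible edges -/

/-- `K` is a union of components of `G - {x, y, z}`, but not all of it. -/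
structure IsFragment (G : SimpleGraph V) (x y z : V) (K : Set V) : Prop where
  nonempty : K.Nonempty
  subset : K ⊆ {x, y, z}ᶜ
  exists_notMem : ∃ v ∈ ({x, y, z}ᶜ : Set V), v ∉ K
  closed : ∀ a ∈ K, ∀ b ∈ ({x, y, z}ᶜ : Set V), G.Adj a b → b ∈ K

lemma exists_isFragment_of_not_cutConnected {G : SimpleGraph V} {x y z a b : V}
    (h : ¬ CutConnected G {x, y, z}ᶜ) (hab : G.Adj a b) :
    ∃ L, IsFragment G x y z L ∧ a ∉ L ∧ b ∉ L := by
  simp only [CutConnected, not_forall] at h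
  obtain ⟨A, ⟨u, hu, huA⟩, ⟨v, hv, hvA⟩, h⟩ := h
  have h1 : IsFragment G x y z ({x, y, z}ᶜ ∩ A) :=
    ⟨⟨u, hu, huA⟩, Set.inter_subset_left, ⟨v, hv, fun h => hvA h.2⟩,
      fun a ha b hb hab => ⟨hb, by_contra fun hn => h ⟨a, ha.1, ha.2, b, hb, hn, hab⟩⟩⟩
  have h2 : IsFragment G x y z ({x, y, z}ᶜ \ A) :=
    ⟨⟨v, hv, hvA⟩, Set.sdiff_subset, ⟨u, hu, fun h => h.2 huA⟩,
      fun a ha b hb hab => ⟨hb, fun hn => h ⟨b, hb, hn, a, ha.1, ha.2, hab.symm⟩⟩⟩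
  by_cases hA : a ∉ ({x, y, z}ᶜ ∩ A : Set V) ∧ b ∉ ({x, y, z}ᶜ ∩ A : Set V)
  · exact ⟨_, h1, hA⟩
  · refine ⟨_, h2, ?_, ?_⟩
    · intro ha
      have hb : b ∈ ({x, y, z}ᶜ ∩ A : Set V) := by
        by_contra hb
        exact hA ⟨fun h => ha.2 h.2, hb⟩
      exact ha.2 (h1.closed b hb a ha.1 hab.symm).2
    · intro hb
      have ha : a ∈ ({x, y, z}ᶜ ∩ A : Set V) := by
        by_contra ha
        exact hA ⟨ha, fun h => hb.2 h.2⟩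
      exact hb.2 (h1.closed a ha b hb.1 hab).2

lemma IsFragment.exists_adj {G : SimpleGraph V} (h3 : ThreeConnected G) {x y z : V} {K : Set V}
    (h : IsFragment G x y z K) : ∃ u ∈ K, G.Adj u z := by
  obtain ⟨a, ha⟩ := h.nonempty
  have hsub : ({x, y, z}ᶜ : Set V) ⊆ {x, y}ᶜ := Set.compl_subset_compl.2 (by grind)
  obtain ⟨v, hv, hvK⟩ := h.exists_notMem
  obtain ⟨u, -, hu, b, hb, hbK, hub⟩ := h3.cutConnected_compl_pair x y K
    ⟨a, hsub (h.subset ha), ha⟩ ⟨v, hsub hv, hvK⟩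
  refine ⟨u, hu, ?_⟩
  by_contra hn
  refine hbK (h.closed u hu b ?_ hub)
  simp only [Set.mem_compl_iff, Set.mem_insert_iff, Set.mem_singleton_iff, not_or] at hb ⊢
  exact ⟨hb.1, hb.2, fun h => hn (h ▸ hub)⟩

/-- Every 3-connected graph with at least two vertices has a contractible edge. -/
lemma ThreeConnected.exists_contractibleEdge [Finite V] [Nontrivial V] {G : SimpleGraph V}
    (h3 : ThreeConnected G) : ∃ x y, ContractibleEdge G x y := by
  by_contra! hcon
  have hcut : ∀ x y, G.Adj x y → ∃ z, ¬ CutConnected G {x, y, z}ᶜ := by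
    intro x y hxy
    by_contra! h
    exact hcon x y ⟨hxy, h⟩
  have key : ∀ m x y z (K : Set V), K.ncard = m → G.Adj x y → ¬ IsFragment G x y z K := by
    intro m
    induction m using Nat.strong_induction_on with
    | _ m ih =>
    rintro x y z K rfl hxy hK
    obtain ⟨u, hu, huz⟩ := hK.exists_adj h3
    obtain ⟨w, hw⟩ := hcut z u huz.symm
    obtain ⟨L, hL, hxL, hyL⟩ := exists_isFragment_of_not_cutConnected hw hxy
    have hzL : z ∉ L := fun h => hL.subset h (by simp)
    have huL : u ∉ L := fun h => hL.subset h (by simp)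
    have hLK : ∀ a ∈ K, ∀ b ∈ L, G.Adj a b → b ∈ K := by
      intro a ha b hb hab
      refine hK.closed a ha b ?_ hab
      simp only [Set.mem_compl_iff, Set.mem_insert_iff, Set.mem_singleton_iff, not_or]
      exact ⟨fun h => hxL (h ▸ hb), fun h => hyL (h ▸ hb), fun h => hzL (h ▸ hb)⟩
    have hswap : ({w, z, u} : Set V) = {z, u, w} := by grind
    have hswap' : ({z, w, u} : Set V) = {z, u, w} := by grind
    have hL' : IsFragment G z w u L := by
      obtain ⟨h1, h2, h3, h4⟩ := hL
      rw [← hswap'] at h2 h3 h4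
      exact ⟨h1, h2, h3, h4⟩
    obtain ⟨a, ha, hau⟩ := hL'.exists_adj h3
    have hcard : (L ∩ K).ncard < K.ncard :=
      Set.ncard_lt_ncard ⟨Set.inter_subset_right, fun h => huL (h hu).1⟩
    obtain ⟨v, hv, hvL⟩ := hL.exists_notMem
    refine ih _ hcard z u w (L ∩ K) rfl huz.symm ⟨⟨a, ha, hLK u hu a ha hau.symm⟩,
      fun b hb => hL.subset hb.1, ⟨v, hv, fun h => hvL h.1⟩, fun b hb c hc hbc => ?_⟩
    have hcL := hL.closed b hb.1 c hc hbc
    exact ⟨hcL, hLK b hb.2 c hcL hbc⟩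
  obtain ⟨s, t, hst⟩ := exists_pair_ne V
  have h0 := (threeConnected_iff_cutConnected.1 h3 ∅ (by simp)).1
  obtain ⟨x, -, -, y, -, -, hxy⟩ := h0 {s} ⟨s, by simp, rfl⟩ ⟨t, by simp, hst.symm⟩
  obtain ⟨z, hz⟩ := hcut x y hxy
  obtain ⟨L, hL, -⟩ := exists_isFragment_of_not_cutConnected hz hxy
  exact key _ x y z L rfl hxy hL

/-! ### Contracting an edge -/

/-- The surjection `π` identifies `x` with `y` and no other pair of vertices. -/
structure Identifies (π : V → W) (x y : V) : Prop where
  surj : π.Surjective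
  eq_iff : ∀ u v, π u = π v ↔ u = v ∨ (u = x ∧ v = y) ∨ (u = y ∧ v = x)

lemma Identifies.symm {π : V → W} {x y : V} (h : Identifies π x y) : Identifies π y x :=
  ⟨h.surj, fun u v => (h.eq_iff u v).trans (or_congr_right or_comm)⟩

lemma Identifies.eq {π : V → W} {x y : V} (h : Identifies π x y) : π x = π y :=
  (h.eq_iff x y).2 (.inr (.inl ⟨rfl, rfl⟩))

lemma exists_identifies {x y : V} (hxy : x ≠ y) :
    ∃ π : V → {v // v ≠ y}, Identifies π x y := by
  classical
  refine ⟨fun v => if h : v = y then ⟨x, hxy⟩ else ⟨v, h⟩, fun v => ⟨v, by simp [v.2]⟩, ?_⟩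
  intro u v
  split_ifs <;> simp <;> grind

/-- The simple graph obtained from `G` by identifying vertices with the same image under `π`. -/
def quotientGraph (G : SimpleGraph V) (π : V → W) : SimpleGraph W where
  Adj a b := a ≠ b ∧ ∃ u v, π u = a ∧ π v = b ∧ G.Adj u v
  symm := ⟨fun _ _ ⟨hne, u, v, hu, hv, huv⟩ => ⟨hne.symm, v, u, hv, hu, huv.symm⟩⟩
  loopless := ⟨fun _ h => h.1 rfl⟩

lemma CutConnected.image {G : SimpleGraph V} {S : Set V} (h : CutConnected G S) (π : V → W) :
    CutConnected (quotientGraph G π) (π '' S) := by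
  rintro A ⟨_, ⟨u, hu, rfl⟩, huA⟩ ⟨_, ⟨v, hv, rfl⟩, hvA⟩
  obtain ⟨a, ha, haA, b, hb, hbA, hab⟩ := h (π ⁻¹' A) ⟨u, hu, huA⟩ ⟨v, hv, hvA⟩
  exact ⟨π a, ⟨a, ha, rfl⟩, haA, π b, ⟨b, hb, rfl⟩, hbA,
    fun h => hbA (h ▸ haA : π b ∈ A), a, b, rfl, rfl, hab⟩

section

variable {G : SimpleGraph V} {π : V → W} {x y : V}

lemma CutConnected.preimage (hπ : Identifies π x y) (hxy : G.Adj x y) {T : Set W}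
    (h : CutConnected (quotientGraph G π) T) : CutConnected G (π ⁻¹' T) := by
  rintro A ⟨u, hu, huA⟩ ⟨v, hv, hvA⟩
  by_contra hc
  have hsat : ∀ u v, π u ∈ T → π u = π v → u ∈ A → v ∈ A := by
    intro u v hu huv huA
    by_contra hvA
    have hv : π v ∈ T := huv ▸ hu
    rcases (hπ.eq_iff u v).1 huv with rfl | ⟨rfl, rfl⟩ | ⟨rfl, rfl⟩
    · exact hvA huA
    · exact hc ⟨_, hu, huA, _, hv, hvA, hxy⟩
    · exact hc ⟨_, hu, huA, _, hv, hvA, hxy.symm⟩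
  obtain ⟨_, ha, ⟨a', ha'A, rfl⟩, _, hb, hbA, -, a, b, hae, rfl, hab⟩ := h (π '' A)
    ⟨π u, hu, u, huA, rfl⟩ ⟨π v, hv, fun ⟨w, hw, hwv⟩ => hvA (hsat w v (by rwa [hwv]) hwv hw)⟩
  exact hc ⟨a, by rwa [Set.mem_preimage, hae], hsat a' a ha hae.symm ha'A, b, hb,
    fun hbA' => hbA ⟨b, hbA', rfl⟩, hab⟩

lemma IsMinor.of_quotientGraph {U : Type*} {K : SimpleGraph U} (hπ : Identifies π x y)
    (hxy : G.Adj x y) (h : IsMinor K (quotientGraph G π)) : IsMinor K G := by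
  rw [isMinor_iff_cutConnected] at h ⊢
  obtain ⟨f, hne, hc, hd, ht⟩ := h
  refine ⟨fun i => π ⁻¹' f i, fun i => (hne i).preimage hπ.surj, fun i => (hc i).preimage hπ hxy,
    fun i j hij => (hd hij).preimage π, fun i j hij => ?_⟩
  obtain ⟨_, ha, _, hb, -, u, v, rfl, rfl, huv⟩ := ht i j hij
  exact ⟨u, ha, v, hb, huv⟩

lemma Planar.planar_quotientGraph (hπ : Identifies π x y) (hxy : G.Adj x y) (h : Planar G) :
    Planar (quotientGraph G π) :=
  ⟨fun hm => h.1 (hm.of_quotientGraph hπ hxy), fun hm => h.2 (hm.of_quotientGraph hπ hxy)⟩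

lemma ThreeConnected.threeConnected_quotientGraph [Finite V] (h3 : ThreeConnected G)
    (hπ : Identifies π x y) (he : ContractibleEdge G x y) (hcard : 3 ≤ Nat.card W) :
    ThreeConnected (quotientGraph G π) := by
  have : Finite W := Finite.of_surjective π hπ.surj
  rw [threeConnected_iff_cutConnected]
  intro S hS
  refine ⟨?_, ?_⟩
  · rw [← Set.image_preimage_eq Sᶜ hπ.surj, Set.preimage_compl]
    refine CutConnected.image ?_ π
    by_cases hxS : π x ∈ S
    · obtain ⟨w, hw⟩ : ∃ w, S = {π x, w} := by
        have h1 : (S \ {π x}).ncard ≤ 1 := by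
          have := Set.ncard_sdiff_singleton_add_one hxS
          omega
        rcases (S \ {π x}).eq_empty_or_nonempty with h0 | ⟨w, hw⟩
        · exact ⟨π x, by rw [← Set.insert_sdiff_self_of_mem hxS, h0]; simp⟩
        · refine ⟨w, ?_⟩
          have : ∀ v ∈ S \ {π x}, v = w := fun v hv =>
            (Set.ncard_le_one_iff).1 h1 hv hw
          rw [← Set.insert_sdiff_self_of_mem hxS]
          exact congrArg _ (Set.eq_singleton_iff_unique_mem.2 ⟨hw, this⟩)
      obtain ⟨z, rfl⟩ := hπ.surj w
      convert he.conn z using 2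
      ext v
      simp only [hw, Set.mem_preimage, Set.mem_insert_iff, Set.mem_singleton_iff, hπ.eq_iff]
      grind
    · refine (threeConnected_iff_cutConnected.1 h3 _ ?_).1
      refine (Set.ncard_le_ncard_of_injOn π (fun v hv => hv) ?_).trans hS
      intro u hu v hv huv
      rcases (hπ.eq_iff u v).1 huv with h | ⟨rfl, rfl⟩ | ⟨rfl, rfl⟩
      · exact h
      · exact absurd hu hxS
      · exact absurd hv hxS
  · by_contra hne
    rw [Set.not_nonempty_iff_eq_empty, Set.compl_empty_iff] at hne
    rw [hne, Set.ncard_univ] at hS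
    omega

/-- Contracting an edge loses that edge and one edge for every common neighbour of its ends. -/
lemma ncard_edgeSet_quotientGraph [Finite V] (hπ : Identifies π x y) (hxy : G.Adj x y) :
    (quotientGraph G π).edgeSet.ncard + (G.neighborSet x ∩ G.neighborSet y).ncard + 1 ≤
      G.edgeSet.ncard := by
  have hne := hxy.ne
  let B : Set (Sym2 V) := insert s(x, y)
    ((fun w => s(y, w)) '' (G.neighborSet x ∩ G.neighborSet y))
  have hB : B.ncard = (G.neighborSet x ∩ G.neighborSet y).ncard + 1 := by
    rw [Set.ncard_insert_of_notMem, Set.ncard_image_of_injective]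
    · intro u v h
      simp only [Sym2.eq_iff] at h
      grind
    · rintro ⟨w, ⟨hw, -⟩, hw'⟩
      have : w = x := by
        simp only [Sym2.eq_iff] at hw'
        grind
      exact G.loopless.irrefl _ (this ▸ hw : G.Adj x x)
  have hBG : B ⊆ G.edgeSet := by
    rintro _ (rfl | ⟨w, ⟨-, hw⟩, rfl⟩)
    · exact hxy
    · exact hw
  have hsub : (quotientGraph G π).edgeSet ⊆ Sym2.map π '' (G.edgeSet \ B) := by
    intro e he
    induction e with | _ a b =>
    obtain ⟨hab, u, v, rfl, rfl, huv⟩ := he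
    by_cases hmem : s(u, v) ∈ B
    · rcases hmem with h | ⟨w, ⟨hxw, hyw⟩, hw⟩
      · have := hπ.eq
        simp only [Sym2.eq_iff] at h
        grind
      · refine ⟨s(x, w), ⟨hxw, ?_⟩, ?_⟩
        · have hwx : G.Adj x w := hxw
          have hwy : G.Adj y w := hyw
          have := hwx.ne
          have := hwy.ne
          rintro (h | ⟨w', -, h⟩)
          · simp only [Sym2.eq_iff] at h
            grind
          · simp only [Sym2.eq_iff] at h
            grind
        · rw [← Sym2.map_mk, ← hw]
          simp [hπ.eq]
    · exact ⟨s(u, v), ⟨huv, hmem⟩, rfl⟩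
  have h1 := (Set.ncard_le_ncard hsub).trans (Set.ncard_image_le)
  have h2 := Set.ncard_sdiff_add_ncard_of_subset hBG
  omega

end

section

variable {G : SimpleGraph V} {C : Set V} {π : V → W} {x y : V}

lemma IsInducedCycle.eq_or_eq_of_adj {a b c v : V} (h : IsInducedCycle G C) (hv : v ∈ C)
    (ha : a ∈ C) (hb : b ∈ C) (hc : c ∈ C) (hva : G.Adj v a) (hvb : G.Adj v b) (hvc : G.Adj v c)
    (hab : a ≠ b) : c = a ∨ c = b :=
  eq_or_eq_of_mem_of_ncard_eq_two ((isInducedCycle_iff.1 h).2.2 v hv) ⟨hva, ha⟩ ⟨hvb, hb⟩ hab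
    ⟨hvc, hc⟩

lemma IsInducedCycle.eq_triangle {a b c : V} (h : IsInducedCycle G C)
    (ha : a ∈ C) (hb : b ∈ C) (hc : c ∈ C) (hab : G.Adj a b) (hac : G.Adj a c) (hbc : G.Adj b c) :
    C = {a, b, c} := by
  refine Set.Subset.antisymm (fun w hw => ?_) (by grind)
  by_contra hwn
  obtain ⟨u, hu, hu', v, hv, hv', huv⟩ :=
    (isInducedCycle_iff.1 h).2.1 {a, b, c} ⟨a, ha, by simp⟩ ⟨w, hw, hwn⟩
  rcases hu' with rfl | rfl | rfl
  · rcases h.eq_or_eq_of_adj ha hb hc hv hab hac huv hbc.ne with rfl | rfl <;> simp at hv'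
  · rcases h.eq_or_eq_of_adj hb ha hc hv hab.symm hbc huv hac.ne with rfl | rfl <;> simp at hv'
  · rcases h.eq_or_eq_of_adj hc ha hb hv hac.symm hbc.symm huv hab.ne with rfl | rfl <;>
      simp at hv'

lemma IsInducedCycle.image (h : IsInducedCycle G C) (hinj : C.InjOn π)
    (hadj : ∀ u ∈ C, ∀ v ∈ C, (quotientGraph G π).Adj (π u) (π v) → G.Adj u v) :
    IsInducedCycle (quotientGraph G π) (π '' C) := by
  rw [isInducedCycle_iff] at h ⊢
  refine ⟨by rw [Set.InjOn.ncard_image hinj]; exact h.1, h.2.1.image π, ?_⟩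
  rintro _ ⟨u, hu, rfl⟩
  have : (quotientGraph G π).neighborSet (π u) ∩ π '' C = π '' (G.neighborSet u ∩ C) := by
    ext w
    constructor
    · rintro ⟨hw, v, hv, rfl⟩
      exact ⟨v, ⟨hadj u hu v hv hw, hv⟩, rfl⟩
    · rintro ⟨v, ⟨huv, hv⟩, rfl⟩
      exact ⟨⟨fun he => G.ne_of_adj huv (hinj hu hv he), u, v, rfl, rfl, huv⟩, v, hv, rfl⟩
  rw [this, Set.InjOn.ncard_image (hinj.mono Set.inter_subset_right), h.2.2 u hu]

lemma Identifies.injOn (hπ : Identifies π x y) (h : x ∉ C ∨ y ∉ C) : C.InjOn π := by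
  intro u hu v hv huv
  rcases (hπ.eq_iff u v).1 huv with h' | ⟨rfl, rfl⟩ | ⟨rfl, rfl⟩
  · exact h'
  · tauto
  · tauto

lemma IsNonsepCycle.image_of_notMem_of_notMem (hπ : Identifies π x y) (h : IsNonsepCycle G C)
    (hx : x ∉ C) (hy : y ∉ C) : IsNonsepCycle (quotientGraph G π) (π '' C) := by
  obtain ⟨h, hns⟩ := h
  rw [induce_preconnected_iff_cutConnected] at hns
  refine ⟨h.image (hπ.injOn (.inl hx)) ?_, ?_⟩
  · rintro u hu v hv ⟨hne, u', v', hu', hv', huv⟩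
    rw [hπ.eq_iff] at hu' hv'
    grind
  · rw [induce_preconnected_iff_cutConnected]
    convert hns.image π
    ext w
    obtain ⟨u, rfl⟩ := hπ.surj w
    simp only [Set.mem_compl_iff, Set.mem_image, hπ.eq_iff]
    grind

lemma IsNonsepCycle.adj_of_adj [Finite V] (h : IsNonsepCycle G C) (hpl : Planar G)
    (he : ContractibleEdge G x y) (hx : x ∈ C) (hy : y ∉ C) {v : V} (hv : v ∈ C) (hvx : v ≠ x)
    (hyv : G.Adj y v) : G.Adj x v := by
  obtain ⟨h, hns⟩ := h
  rw [induce_preconnected_iff_cutConnected] at hns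
  obtain ⟨n, q, hq⟩ := h.exists_cycleEnum hx
  obtain ⟨k, hk, rfl⟩ := (hq.mem_iff v).1 hv
  have hk0 : 1 ≤ k := by
    rcases Nat.eq_zero_or_pos k with rfl | h
    · exact absurd hq.zero hvx
    · exact h
  rcases hq.eq_first_or_last_of_adj he hy hns hpl hk0 hk hyv with rfl | rfl
  · exact hq.adj_first
  · exact hq.adj_last

lemma IsNonsepCycle.image_of_mem_of_notMem [Finite V] (hπ : Identifies π x y)
    (h : IsNonsepCycle G C) (hpl : Planar G) (he : ContractibleEdge G x y)
    (hx : x ∈ C) (hy : y ∉ C) : IsNonsepCycle (quotientGraph G π) (π '' C) := by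
  have hyx := fun v hv => h.adj_of_adj hpl he hx hy (v := v) hv
  obtain ⟨n, q, hq⟩ := h.1.exists_cycleEnum hx
  have hZ := hq.cutConnected_compl_insert he hy
    (induce_preconnected_iff_cutConnected.1 h.2) hpl
  refine ⟨h.1.image (hπ.injOn (.inr hy)) ?_, ?_⟩
  · rintro u hu v hv ⟨hne, u', v', hu', hv', huv⟩
    have hne' := G.ne_of_adj huv
    rw [Ne, hπ.eq_iff] at hne
    rw [hπ.eq_iff] at hu' hv'
    have hsymm := fun a b => G.adj_comm a b
    grind
  · rw [induce_preconnected_iff_cutConnected]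
    convert hZ.image π
    ext w
    obtain ⟨u, rfl⟩ := hπ.surj w
    simp only [Set.mem_compl_iff, Set.mem_image, hπ.eq_iff, Set.mem_ofPred_eq]
    grind

lemma IsNonsepCycle.image_of_mem_of_mem [Finite V] (hπ : Identifies π x y)
    (h : IsNonsepCycle G C) (hxy : G.Adj x y) (hx : x ∈ C) (hy : y ∈ C) (h4 : C.ncard ≠ 3) :
    IsNonsepCycle (quotientGraph G π) (π '' C) := by
  obtain ⟨h, hns⟩ := h
  rw [induce_preconnected_iff_cutConnected] at hns
  have hne := hxy.ne
  have hcommon : ∀ u ∈ C, G.Adj u x → ¬ G.Adj u y := by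
    intro u hu hux huy
    rw [h.eq_triangle hu hx hy hux huy hxy] at h4
    exact h4 (Set.ncard_eq_three.2 ⟨u, x, y, hux.ne, huy.ne, hne, rfl⟩)
  have h' := isInducedCycle_iff.1 h
  have himg : π '' C = π '' (C \ {y}) := by
    ext w
    obtain ⟨u, rfl⟩ := hπ.surj w
    simp only [Set.mem_image, hπ.eq_iff, Set.mem_sdiff, Set.mem_singleton_iff]
    grind
  refine ⟨isInducedCycle_iff.2 ⟨?_, h'.2.1.image π, ?_⟩, ?_⟩
  · have := Set.ncard_sdiff_singleton_add_one hy
    rw [himg, Set.InjOn.ncard_image (hπ.injOn (.inr (by simp)))]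
    omega
  · have key : ∀ {x y : V}, Identifies π x y → G.Adj x y → x ∈ C → y ∈ C →
        (∀ u ∈ C, G.Adj u x → ¬ G.Adj u y) →
        ((quotientGraph G π).neighborSet (π x) ∩ π '' C).ncard = 2 := by
      intro x y hπ hxy hx hy hcommon
      obtain ⟨a, ha⟩ : ∃ a, a ∈ (G.neighborSet x ∩ C) \ {y} := by
        refine (Set.ncard_pos).1 ?_
        have := Set.ncard_sdiff_singleton_add_one (show y ∈ G.neighborSet x ∩ C from ⟨hxy, hy⟩)
        have := h'.2.2 x hx
        omega
      obtain ⟨b, hb⟩ : ∃ b, b ∈ (G.neighborSet y ∩ C) \ {x} := by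
        refine (Set.ncard_pos).1 ?_
        have := Set.ncard_sdiff_singleton_add_one
          (show x ∈ G.neighborSet y ∩ C from ⟨hxy.symm, hx⟩)
        have := h'.2.2 y hy
        omega
      obtain ⟨⟨hxa, haC⟩, hay⟩ := ha
      obtain ⟨⟨hyb, hbC⟩, hbx⟩ := hb
      rw [mem_neighborSet] at hxa hyb
      have hax := hxa.ne
      have hby := hyb.ne
      have hab : a ≠ b := fun h => hcommon a haC hxa.symm (h ▸ hyb.symm)
      refine Set.ncard_eq_two.2 ⟨π a, π b, ?_, ?_⟩
      · rw [Ne, hπ.eq_iff]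
        grind
      · have h1 := fun c hc hxc => h.eq_or_eq_of_adj (c := c) hx hy haC hc hxy hxa hxc (Ne.symm hay)
        have h2 := fun c hc hyc =>
          h.eq_or_eq_of_adj (c := c) hy hx hbC hc hxy.symm hyb hyc (Ne.symm hbx)
        ext w
        constructor
        · rintro ⟨⟨hne, u, v, hu, hv, huv⟩, c, hc, rfl⟩
          have hvC : v ∈ C := by
            rw [hπ.eq_iff] at hv
            grind
          rw [← hv] at hne ⊢
          simp only [Set.mem_insert_iff, Set.mem_singleton_iff, hπ.eq_iff]
          rw [Ne, hπ.eq_iff] at hne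
          rw [hπ.eq_iff] at hu
          grind
        · rintro (rfl | rfl)
          · exact ⟨⟨fun h => by rw [hπ.eq_iff] at h; grind, x, a, rfl, rfl, hxa⟩, a, haC, rfl⟩
          · exact ⟨⟨fun h => by rw [hπ.eq_iff] at h; grind, y, b, hπ.eq.symm, rfl, hyb⟩, b, hbC,
              rfl⟩
    rintro _ ⟨u, hu, rfl⟩
    by_cases hux : u = x
    · subst hux
      exact key hπ hxy hx hy hcommon
    by_cases huy : u = y
    · subst huy
      exact key hπ.symm hxy.symm hy hx fun v hv h1 h2 => hcommon v hv h2 h1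
    have : (quotientGraph G π).neighborSet (π u) ∩ π '' C = π '' (G.neighborSet u ∩ C) := by
      ext w
      constructor
      · rintro ⟨⟨hne, u', v', hu', hv', huv⟩, v, hv, rfl⟩
        refine ⟨v', ?_, hv'⟩
        rw [hπ.eq_iff] at hu' hv'
        obtain rfl : u' = u := by grind
        exact ⟨huv, by grind⟩
      · rintro ⟨v, ⟨huv, hv⟩, rfl⟩
        refine ⟨⟨fun he => ?_, u, v, rfl, rfl, huv⟩, v, hv, rfl⟩
        have := G.ne_of_adj huv
        rw [hπ.eq_iff] at he
        grind
    rw [this, Set.InjOn.ncard_image (hπ.injOn ?_), h'.2.2 u hu]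
    by_contra! hc
    exact hcommon u hu hc.1.1 hc.2.1
  · rw [induce_preconnected_iff_cutConnected]
    convert hns.image π
    ext w
    obtain ⟨u, rfl⟩ := hπ.surj w
    simp only [Set.mem_compl_iff, Set.mem_image, hπ.eq_iff]
    grind

end

/-! ### Counting induced nonseparating cycles -/

section

variable {G : SimpleGraph V} {π : V → W} {x y : V}

lemma IsNonsepCycle.image [Finite V] (hπ : Identifies π x y) (hpl : Planar G)
    (he : ContractibleEdge G x y) {C : Set V} (h : IsNonsepCycle G C)
    (h3 : ¬ (x ∈ C ∧ y ∈ C ∧ C.ncard = 3)) : IsNonsepCycle (quotientGraph G π) (π '' C) := by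
  by_cases hx : x ∈ C <;> by_cases hy : y ∈ C
  · exact h.image_of_mem_of_mem hπ he.adj hx hy fun hc => h3 ⟨hx, hy, hc⟩
  · exact h.image_of_mem_of_notMem hπ hpl he hx hy
  · exact h.image_of_mem_of_notMem hπ.symm hpl he.symm hy hx
  · exact h.image_of_notMem_of_notMem hπ hx hy

lemma IsNonsepCycle.eq_of_image_eq [Finite V] (hG : ThreeConnected G) (hπ : Identifies π x y)
    (hpl : Planar G) (he : ContractibleEdge G x y) (hcard : 5 ≤ Nat.card V) {C C' : Set V}
    (h : IsNonsepCycle G C) (h' : IsNonsepCycle G C') (hCC : π '' C = π '' C') : C = C' := by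
  have hne := he.adj.ne
  have hmem : ∀ u, (u ∈ C ∨ (u = x ∧ y ∈ C) ∨ (u = y ∧ x ∈ C)) ↔
      (u ∈ C' ∨ (u = x ∧ y ∈ C') ∨ (u = y ∧ x ∈ C')) := by
    intro u
    have := Set.ext_iff.1 hCC (π u)
    simp only [Set.mem_image, hπ.eq_iff] at this
    grind
  by_cases hs : C ⊆ C'
  · exact h.1.eq_of_subset h'.1 hs
  by_cases hs' : C' ⊆ C
  · exact (h'.1.eq_of_subset h.1 hs').symm
  by_cases hx : x ∈ C
  · have hy : y ∉ C := fun hy => hs' fun u hu => by grind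
    have : C' = insert y (C \ {x}) := by grind
    exact absurd (this ▸ h') (not_isNonsepCycle_exchange hG hpl he hcard hx hy h)
  · have hy : y ∈ C := by
      by_contra hy
      exact hs fun u hu => by grind
    have : C' = insert x (C \ {y}) := by grind
    exact absurd (this ▸ h') (not_isNonsepCycle_exchange hG hpl he.symm hcard hy hx h)

lemma ncard_nonsepCycles_le_quotientGraph [Finite V] (hG : ThreeConnected G)
    (hπ : Identifies π x y) (hpl : Planar G) (he : ContractibleEdge G x y)
    (hcard : 5 ≤ Nat.card V) :
    (nonsepCycles G).ncard ≤
      (nonsepCycles (quotientGraph G π)).ncard + (G.neighborSet x ∩ G.neighborSet y).ncard := by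
  have : Finite W := Finite.of_surjective π hπ.surj
  let T : Set (Set V) := {C | x ∈ C ∧ y ∈ C ∧ C.ncard = 3}
  have h1 : (nonsepCycles G \ T).ncard ≤ (nonsepCycles (quotientGraph G π)).ncard :=
    Set.ncard_le_ncard_of_injOn (fun C => π '' C) (fun C hC => hC.1.image hπ hpl he hC.2)
      fun C hC C' hC' hCC => hC.1.eq_of_image_eq hG hπ hpl he hcard hC'.1 hCC
  have h2 : (nonsepCycles G ∩ T).ncard ≤ (G.neighborSet x ∩ G.neighborSet y).ncard := by
    refine (Set.ncard_le_ncard (t := (fun w => {x, y, w}) '' (G.neighborSet x ∩ G.neighborSet y))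
      ?_).trans Set.ncard_image_le
    rintro C ⟨⟨hC, -⟩, hx, hy, h3⟩
    obtain ⟨w, hw⟩ : ∃ w, w ∈ C \ {x, y} := by
      refine (Set.ncard_pos).1 ?_
      have := Set.le_ncard_sdiff {x, y} C
      rw [Set.ncard_pair he.adj.ne] at this
      omega
    have hCw : C = {x, y, w} := by
      refine (Set.eq_of_subset_of_ncard_le (s := {x, y, w}) (t := C) (by grind) ?_).symm
      rw [h3, Set.ncard_eq_three.2 ⟨x, y, w, he.adj.ne, by grind, by grind, rfl⟩]
    have key : ∀ {x y : V}, x ∈ C → C = {x, y, w} → G.Adj x w := by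
      intro x y hx hCw
      have hle : G.neighborSet x ∩ C ⊆ {y, w} := by
        rintro v ⟨hxv, hv⟩
        have := G.ne_of_adj hxv
        grind
      have heq := Set.eq_of_subset_of_ncard_le hle (by
        rw [(isInducedCycle_iff.1 hC).2.2 x hx]
        exact (Set.ncard_insert_le _ _).trans (by simp))
      exact (heq ▸ Set.mem_insert_of_mem _ rfl : w ∈ G.neighborSet x ∩ C).1
    exact ⟨w, ⟨key hx hCw, key hy (hCw.trans (Set.insert_comm _ _ _))⟩, hCw.symm⟩
  have := Set.ncard_inter_add_ncard_sdiff_eq_ncard (nonsepCycles G) T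
  omega

end

lemma ncard_setOf_card_le_ncard_add_one [Finite V] :
    {C : Set V | Nat.card V ≤ C.ncard + 1}.ncard ≤ Nat.card V + 1 := by
  have hsub : {C : Set V | Nat.card V ≤ C.ncard + 1} ⊆
      insert Set.univ ((fun v => {v}ᶜ) '' (Set.univ : Set V)) := by
    intro C (hC : Nat.card V ≤ C.ncard + 1)
    have hadd := Set.ncard_add_ncard_compl C
    have h1 : Cᶜ.ncard ≤ 1 := by omega
    rcases Cᶜ.eq_empty_or_nonempty with h0 | ⟨v, hv⟩
    · exact .inl (Set.compl_empty_iff.1 h0)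
    · refine .inr ⟨v, trivial, ?_⟩
      rw [← compl_compl C]
      exact congrArg _ (Set.eq_singleton_iff_unique_mem.2
        ⟨hv, fun w hw => (Set.ncard_le_one_iff).1 h1 hw hv⟩).symm
  refine (Set.ncard_le_ncard hsub).trans ((Set.ncard_insert_le _ _).trans ?_)
  exact Nat.succ_le_succ ((Set.ncard_image_le).trans (Set.ncard_univ V).le)

lemma ThreeConnected.three_le_card [Finite V] {G : SimpleGraph V} (h : ThreeConnected G) :
    3 ≤ Nat.card V := by
  by_contra! hlt
  have := (threeConnected_iff_cutConnected.1 h Set.univ (by rw [Set.ncard_univ]; omega)).2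
  simp at this

lemma ThreeConnected.eq_top [Finite V] {G : SimpleGraph V} (h : ThreeConnected G)
    (hcard : Nat.card V ≤ 4) : G = ⊤ := by
  ext u v
  refine ⟨fun h => h.ne, fun huv => ?_⟩
  have hadd := Set.ncard_add_ncard_compl {u, v}
  rw [Set.ncard_pair huv] at hadd
  obtain ⟨a, ha, hau, b, hb, hbu, hab⟩ :=
    (threeConnected_iff_cutConnected.1 h {u, v}ᶜ (by omega)).1 {u} ⟨u, by simp, rfl⟩
      ⟨v, by simp, huv.symm⟩
  grind

lemma ncard_edgeSet_top [Finite V] :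
    (⊤ : SimpleGraph V).edgeSet.ncard = (Nat.card V).choose 2 := by
  classical
  have := Fintype.ofFinite V
  rw [← coe_edgeFinset, Set.ncard_coe_finset, card_edgeFinset_top_eq_card_choose_two,
    Nat.card_eq_fintype_card]

/-- A planar 3-connected graph has at most `|E| - |V| + 4` induced nonseparating cycles. -/
theorem ThreeConnected.ncard_nonsepCycles_add_card_le (n : ℕ) :
    ∀ (V : Type*) [Finite V] (G : SimpleGraph V), Nat.card V = n → ThreeConnected G → Planar G →
      (nonsepCycles G).ncard + Nat.card V ≤ G.edgeSet.ncard + 4 := by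
  induction n with
  | zero =>
    intro V _ G hn h3
    have := h3.three_le_card
    omega
  | succ n ih =>
    intro V _ G hn h3 hpl
    have hcard := h3.three_le_card
    have : Nontrivial V := Finite.one_lt_card_iff_nontrivial.1 (by omega)
    by_cases h5 : 5 ≤ Nat.card V
    · obtain ⟨x, y, he⟩ := h3.exists_contractibleEdge
      obtain ⟨π, hπ⟩ := exists_identifies he.adj.ne
      have hW : Nat.card {v // v ≠ y} = n := by
        have := Set.ncard_add_ncard_compl {y}
        rw [Set.ncard_singleton, ← Nat.card_coe_set_eq {y}ᶜ] at this
        change 1 + Nat.card {v // v ≠ y} = _ at this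
        omega
      have h1 := ih _ (quotientGraph G π) hW (h3.threeConnected_quotientGraph hπ he (by omega))
        (hpl.planar_quotientGraph hπ he.adj)
      have h2 := ncard_nonsepCycles_le_quotientGraph h3 hπ hpl he h5
      have h4 := ncard_edgeSet_quotientGraph hπ he.adj
      omega
    · rw [h3.eq_top (by omega), ncard_edgeSet_top]
      have h0 : Nat.card V = 3 ∨ Nat.card V = 4 := by omega
      rcases h0 with h0 | h0
      · have : nonsepCycles (⊤ : SimpleGraph V) ⊆ {Set.univ} := fun C hC =>
          Set.eq_of_subset_of_ncard_le (Set.subset_univ _) (by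
            rw [Set.ncard_univ, h0]
            exact hC.1.1)
        have := Set.ncard_le_ncard this
        rw [Set.ncard_singleton] at this
        omega
      · have : nonsepCycles (⊤ : SimpleGraph V) ⊆ {C | Nat.card V ≤ C.ncard + 1} := by
          intro C hC
          have := hC.1.1
          change Nat.card V ≤ C.ncard + 1
          omega
        have := (Set.ncard_le_ncard this).trans ncard_setOf_card_le_ncard_add_one
        rw [h0] at this ⊢
        rw [show Nat.choose 4 2 = 6 by decide]
        omega

/-- If every finite simple 3-connected graph `G` satisfies
`C(χ(G),3) - C(χ(G),2) + C(χ(G),1) ≤ |C(G)| - |E(G)| + |V(G)|`, then every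
finite simple 3-connected planar graph different from `K₃` has `χ(G) ≤ 4`. -/
theorem stmt16 :
    (∀ (U : Type) [Fintype U] (G : SimpleGraph U), ThreeConnected G →
      ((G.chromaticNumber.toNat).choose 3 : ℤ) - ((G.chromaticNumber.toNat).choose 2 : ℤ)
          + ((G.chromaticNumber.toNat).choose 1 : ℤ)
        ≤ ((nonsepCycles G).ncard : ℤ) - (G.edgeSet.ncard : ℤ) + (Nat.card U : ℤ)) →
    ∀ (U : Type) [Fintype U] (G : SimpleGraph U), ThreeConnected G → Planar G →
      ¬ Nonempty (G ≃g (⊤ : SimpleGraph (Fin 3))) → G.chromaticNumber ≤ 4 := by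
  intro h U _ G h3 hpl _
  by_contra hχ
  have hle := h U G h3
  have hcount := h3.ncard_nonsepCycles_add_card_le _ U G rfl hpl
  have htop : G.chromaticNumber ≠ ⊤ :=
    chromaticNumber_ne_top_iff_exists.2 ⟨_, G.colorable_of_fintype⟩
  obtain ⟨k, hk⟩ := ENat.ne_top_iff_exists.1 htop
  rw [← hk, ENat.toNat_natCast] at hle
  have hk4 : 4 < k := by
    rw [← hk, not_le] at hχ
    exact_mod_cast hχ
  have hchoose : k.choose 2 ≤ k.choose 3 := by
    have := Nat.choose_succ_right_eq k 2
    have : 3 ≤ k - 2 := by omega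
    nlinarith
  rw [Nat.choose_one_right] at hle
  omega
end

section
/- Let G be a finite simple graph with chromatic number c that admits an over-dominating k-colouring. Then k = c if c ≤ 2, and c ≤ k ≤ 2^c - c - 1 otherwise. -/
open SimpleGraph

variable {V : Type*}

/-- `f` is an over-dominating proper colouring of `G` with `k` colour classes:
it is proper and surjective onto the `k` colours, every vertex has a neighbour
in each colour class other than its own, and for each pair of colour classes
one of them has a vertex adjacent to all vertices of the other. -/
def IsOverDominating (G : SimpleGraph V) {k : ℕ} (f : V → Fin k) : Prop :=
  (∀ ⦃x y : V⦄, G.Adj x y → f x ≠ f y) ∧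
  Function.Surjective f ∧
  (∀ x : V, ∀ c : Fin k, c ≠ f x → ∃ y, G.Adj x y ∧ f y = c) ∧
  (∀ c₁ c₂ : Fin k, c₁ ≠ c₂ →
    (∃ x, f x = c₁ ∧ ∀ y, f y = c₂ → G.Adj x y) ∨
    (∃ x, f x = c₂ ∧ ∀ y, f y = c₁ → G.Adj x y))

open Finset in
/-- The images of the classes of an over-dominating colouring under a proper colouring `g` form
an injective family. -/
lemma IsOverDominating.injective_image [Fintype V] {G : SimpleGraph V} {c k : ℕ} {f : V → Fin k}
    (hf : IsOverDominating G f) (g : G.Coloring (Fin c)) :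
    Function.Injective fun i => (univ.filter fun x => f x = i).image g := by
  have key : ∀ i j, (univ.filter fun x => f x = i).image g = (univ.filter fun x => f x = j).image g →
      ¬ ∃ x, f x = i ∧ ∀ y, f y = j → G.Adj x y := by
    rintro i j h ⟨x, hx, hxy⟩
    have hmem : g x ∈ (univ.filter fun x => f x = j).image g :=
      h ▸ mem_image_of_mem g (by simp [hx])
    obtain ⟨y, hy, hgy⟩ := mem_image.1 hmem
    exact g.valid (hxy y (by simpa using hy)) hgy.symm
  intro i j h
  by_contra hij
  exact (hf.2.2.2 i j hij).elim (key i j h) (key j i h.symm)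

open Finset in
/-- If a graph with a proper colouring by `c` colours has an over-dominating `k`-colouring, then
`c` splits as `s + t`, where `s` counts the colour classes common to both colourings, and `k`
is at most `s` plus the number of subsets of size at least two of a `t`-element set. -/
lemma IsOverDominating.exists_add_le [Fintype V] {G : SimpleGraph V} {c k : ℕ} {f : V → Fin k}
    (hf : IsOverDominating G f) (g : G.Coloring (Fin c)) :
    ∃ s t : ℕ, s + t = c ∧ k + t + 1 ≤ s + 2 ^ t := by
  classical
  have hinj := hf.injective_image g
  set S : Fin k → Finset (Fin c) := fun i => (univ.filter fun x => f x = i).image g with hS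
  have memS : ∀ i a, a ∈ S i ↔ ∃ x, f x = i ∧ g x = a := by simp [hS]
  let A : Finset (Fin c) := univ.filter fun a => ∃ j, S j = {a}
  have memA : ∀ a, a ∈ A ↔ ∃ j, S j = {a} := by simp [A]
  have hdisj : Disjoint (univ.image S) (insert ∅ (Aᶜ.image fun a => ({a} : Finset (Fin c)))) := by
    rw [Finset.disjoint_left]
    intro T hT hT'
    obtain ⟨i, -, rfl⟩ := mem_image.1 hT
    rcases mem_insert.1 hT' with h | h
    · obtain ⟨x, hx⟩ := hf.2.1 i
      have : g x ∈ S i := (memS _ _).2 ⟨x, hx, rfl⟩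
      simp [h] at this
    · obtain ⟨a, ha, hai⟩ := mem_image.1 h
      exact mem_compl.1 ha ((memA a).2 ⟨i, hai.symm⟩)
  have hsub : univ.image S ∪ insert ∅ (Aᶜ.image fun a => ({a} : Finset (Fin c))) ⊆
      (A.image fun a => ({a} : Finset (Fin c))) ∪ Aᶜ.powerset := by
    refine union_subset ?_ ?_
    · intro T hT
      obtain ⟨i, -, rfl⟩ := mem_image.1 hT
      by_cases hi : S i ⊆ Aᶜ
      · exact mem_union_right _ (mem_powerset.2 hi)
      obtain ⟨a, hai, haA⟩ := not_subset.1 hi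
      have haA : a ∈ A := by simpa using haA
      obtain ⟨j, hj⟩ := (memA a).1 haA
      obtain ⟨x, hx, hgx⟩ := (memS i a).1 hai
      obtain rfl | hij := eq_or_ne j i
      · exact mem_union_left _ (mem_image.2 ⟨a, haA, hj.symm⟩)
      · obtain ⟨y, hxy, hy⟩ := hf.2.2.1 x j (hx ▸ hij)
        have hgy : g y ∈ S j := (memS _ _).2 ⟨y, hy, rfl⟩
        rw [hj, mem_singleton] at hgy
        exact absurd (hgx.trans hgy.symm) (g.valid hxy)
    · intro T hT
      refine mem_union_right _ (mem_powerset.2 ?_)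
      rcases mem_insert.1 hT with rfl | h
      · simp
      · obtain ⟨a, ha, rfl⟩ := mem_image.1 h
        simpa using ha
  have hcard := (card_le_card hsub).trans (card_union_le _ _)
  rw [card_union_of_disjoint hdisj, card_image_of_injective _ hinj, card_insert_of_notMem (by simp),
    card_image_of_injective _ singleton_injective, card_image_of_injective _ singleton_injective,
    card_powerset, card_univ, Fintype.card_fin] at hcard
  exact ⟨#A, #Aᶜ, by simp, by omega⟩

/-- If a finite simple graph `G` with chromatic number `c` admits an
over-dominating `k`-colouring, then `k = c` if `c ≤ 2`, and
`c ≤ k ≤ 2^c - c - 1` otherwise. -/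
theorem stmt17 [Finite V] (G : SimpleGraph V) {c k : ℕ}
    (hc : G.chromaticNumber = (c : ℕ∞)) (f : V → Fin k) (hf : IsOverDominating G f) :
    (c ≤ 2 → k = c) ∧ (2 < c → (c ≤ k ∧ (k : ℤ) ≤ 2 ^ c - c - 1)) := by
  have := Fintype.ofFinite V
  have hck : c ≤ k := by
    have hcol : G.Colorable k := ⟨Coloring.mk f fun {x y} h => hf.1 h⟩
    exact_mod_cast hc ▸ chromaticNumber_le_iff_colorable.2 hcol
  obtain ⟨g⟩ : G.Colorable c := chromaticNumber_le_iff_colorable.1 hc.le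
  obtain ⟨s, t, rfl, hst⟩ := hf.exists_add_le g
  constructor
  · intro h
    have ht : t ≤ 2 := by omega
    interval_cases t <;> omega
  · intro h
    refine ⟨hck, ?_⟩
    have hpow : 2 ^ t + 2 * s ≤ 2 ^ (s + t) := by
      obtain rfl | ht := t.eq_zero_or_pos
      · obtain ⟨n, rfl⟩ : ∃ n, s = n + 3 := ⟨s - 3, by omega⟩
        have := n.lt_two_pow_self
        simp only [add_zero, pow_zero, pow_add]
        omega
      · have h₁ := s.lt_two_pow_self
        have h₂ : 2 ^ 1 ≤ 2 ^ t := Nat.pow_le_pow_right two_pos ht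
        rw [pow_add]
        nlinarith
    have : k + (s + t) + 1 ≤ 2 ^ (s + t) := by omega
    zify at this
    push_cast
    linarith
end
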